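/- If e(R/I) = 6, then pd(R/I) ≤ 5. -/

import Mathlib

open MvPolynomial Filter CategoryTheory

noncomputable section

/-- The height of an ideal `J`: the infimum of the heights of the prime ideals containing it. -/
def idealHeight {R : Type} [CommRing R] (J : Ideal R) : ℕ∞ :=
  ⨅ p ∈ {p : {q : Ideal R // q.IsPrime} | J ≤ p.1}, Order.height p

/-- `pdQuotLE J n` holds iff `R ⧸ J` admits a projective resolution of length at most `n`,
i.e. the projective dimension of `R ⧸ J` as an `R`-module is at most `n`. -/
def pdQuotLE {R : Type} [CommRing R] (J : Ideal R) (n : ℕ) : Prop :=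
  ∃ P : ProjectiveResolution (ModuleCat.of R (R ⧸ J)),
    ∀ i, n < i → Limits.IsZero (P.complex.X i)

/-- The `p`-primary component of `J` for `p` a minimal prime of `J`:
the saturation of `J` at `p`. -/
def primaryComponent {R : Type} [CommRing R] (J p : Ideal R) : Ideal R :=
  ⨆ (s : R) (_ : s ∉ p), Submodule.colon J (Ideal.span {s})

/-- The unmixed part `J^un` of `J`: the intersection of the primary components of `J`
corresponding to the minimal primes of `J` of minimal height. -/
def unmixedPart {R : Type} [CommRing R] (J : Ideal R) : Ideal R :=
  ⨅ p ∈ {p : Ideal R | p.IsPrime ∧ J ≤ p ∧ idealHeight p = idealHeight J},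
    primaryComponent J p

/-- A linear prime: a prime ideal generated by forms of degree one. -/
def IsLinearPrime {k : Type} [CommSemiring k] {N : ℕ} (p : Ideal (MvPolynomial (Fin N) k)) : Prop :=
  p.IsPrime ∧ ∃ S : Set (MvPolynomial (Fin N) k), (∀ ℓ ∈ S, ℓ.IsHomogeneous 1) ∧ p = Ideal.span S

/-- A homogeneous ideal: an ideal generated by homogeneous elements. -/
def IsHomogeneousIdeal {k : Type} [CommSemiring k] {N : ℕ}
    (J : Ideal (MvPolynomial (Fin N) k)) : Prop :=
  ∃ S : Set (MvPolynomial (Fin N) k), (∀ g ∈ S, ∃ d, g.IsHomogeneous d) ∧ J = Ideal.span S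

/-- `[B]_n`: the ideal generated by all forms of degree `n` belonging to `B`. -/
def degreePart {k : Type} [CommSemiring k] {N : ℕ} (B : Ideal (MvPolynomial (Fin N) k)) (n : ℕ) :
    Ideal (MvPolynomial (Fin N) k) :=
  Ideal.span {f | f ∈ B ∧ f.IsHomogeneous n}

/-- The Hilbert–Samuel function of `R/J` with respect to the irrelevant maximal ideal:
`n ↦ length (R / (J + 𝔪^n)) = dim_k (R / (J + 𝔪^n))`. -/
def hilbertSamuelFn {k : Type} [Field k] {N : ℕ} (J : Ideal (MvPolynomial (Fin N) k))
    (n : ℕ) : ℕ :=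
  Module.finrank k
    (MvPolynomial (Fin N) k ⧸
      (J ⊔ (Ideal.span (Set.range (MvPolynomial.X : Fin N → MvPolynomial (Fin N) k))) ^ n))

/-- `HasMultiplicity J d e`: the quotient `R/J` has Krull dimension `d` and Hilbert–Samuel
multiplicity `e`, expressed through the asymptotics `d! · HS_J(n) / n^d → e` of the
Hilbert–Samuel function. -/
def HasMultiplicity {k : Type} [Field k] {N : ℕ} (J : Ideal (MvPolynomial (Fin N) k))
    (d e : ℕ) : Prop :=
  Tendsto (fun n : ℕ => (Nat.factorial d : ℝ) * (hilbertSamuelFn J n : ℝ) / (n : ℝ) ^ d)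
    atTop (nhds (e : ℝ))

/-- An ideal of `R` is extended from a subalgebra `A` if it is generated by elements of `A`. -/
def extendedFrom {k R : Type} [CommRing k] [CommRing R] [Algebra k R]
    (K : Ideal R) (A : Subalgebra k R) : Prop :=
  ∃ S : Set R, S ⊆ (A : Set R) ∧ K = Ideal.span S


namespace C3
set_option linter.unusedSectionVars false
section P4
variable {A M : Type} [CommRing A] [IsDomain A] [UniqueFactorizationMonoid A] [CommRing M]
  [Algebra A M]

open Polynomial in
theorem free_of_one_gen [Module.Finite A M] (htf : ∀ (a : A) (m : M), a • m = 0 → a = 0 ∨ m = 0)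
    (y : M) (hy : Algebra.adjoin A {y} = ⊤) : Module.Free A M := by
  classical
  have : NormalizedGCDMonoid A := (inferInstance : Nonempty (NormalizedGCDMonoid A)).some
  have hsurj : Function.Surjective (aeval (R := A) y) := by
    rw [← AlgHom.range_eq_top, ← Algebra.adjoin_singleton_eq_range_aeval, hy]
  obtain ⟨q₀, hq₀m, hq₀⟩ := (Algebra.IsIntegral.of_finite A M).isIntegral y
  have hq₀' : aeval y q₀ = 0 := by rw [Polynomial.aeval_def]; exact hq₀
  have hex : ∃ n, ∃ p : A[X], p ≠ 0 ∧ aeval y p = 0 ∧ p.natDegree = n :=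
    ⟨_, q₀, hq₀m.ne_zero, hq₀', rfl⟩
  obtain ⟨p₀, hp₀, hp₀y, hp₀n⟩ := Nat.find_spec hex
  have hmin : ∀ q : A[X], aeval y q = 0 → q.natDegree < p₀.natDegree → q = 0 := by
    intro q hq hlt
    by_contra hne
    exact Nat.find_min hex (hp₀n ▸ hlt) ⟨q, hne, hq, rfl⟩
  set p := p₀.primPart with hp
  have hpp : p.IsPrimitive := p₀.isPrimitive_primPart
  have hpn : p.natDegree = p₀.natDegree := p₀.natDegree_primPart
  have hc : p₀.content ≠ 0 := by rwa [Ne, content_eq_zero_iff]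
  have hpy : aeval y p = 0 := by
    have h := hp₀y
    rw [p₀.eq_C_content_mul_primPart, map_mul, Polynomial.aeval_C, ← Algebra.smul_def] at h
    exact (htf _ _ h).resolve_left hc
  have hp0 : p ≠ 0 := hpp.ne_zero
  let F := FractionRing A
  have hinj : Function.Injective (algebraMap A F) := IsFractionRing.injective A F
  have hdvd : ∀ q : A[X], aeval y q = 0 → p ∣ q := by
    intro q hq
    by_cases hd : p.natDegree = 0
    · have hpC := eq_C_of_natDegree_eq_zero hd
      have hu : IsUnit (p.coeff 0) := hpp _ (by rw [← hpC])
      rw [hpC]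
      exact (hu.map Polynomial.C).dvd
    apply hpp.dvd_of_fraction_map_dvd_fraction_map (K := F)
    set h := q.map (algebraMap A F) / p.map (algebraMap A F) with hh
    obtain ⟨c, hcM, hcn⟩ := IsLocalization.integerNormalization_spec (nonZeroDivisors A) h
    set h' := IsLocalization.integerNormalization (nonZeroDivisors A) h
    have hc0 : c ≠ 0 := nonZeroDivisors.ne_zero hcM
    have hmod : (Polynomial.C c * q - h' * p).map (algebraMap A F) =
        c • (q.map (algebraMap A F) % p.map (algebraMap A F)) := by
      rw [Polynomial.map_sub, Polynomial.map_mul, Polynomial.map_mul, hcn, Polynomial.map_C,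
        EuclideanDomain.mod_eq_sub_mul_div, ← hh, smul_sub, Algebra.smul_def, Algebra.smul_def,
        Algebra.smul_def]
      have e : algebraMap A F[X] c = Polynomial.C (algebraMap A F c) := rfl
      rw [e]
      ring
    have hz : Polynomial.C c * q - h' * p = 0 := by
      apply hmin
      · simp [hq, hpy]
      · rw [← hpn, ← natDegree_map_eq_of_injective hinj, hmod]
        refine lt_of_le_of_lt (natDegree_smul_le _ _) ?_
        rw [← natDegree_map_eq_of_injective hinj p]
        apply natDegree_mod_lt
        rwa [natDegree_map_eq_of_injective hinj]
    have : q.map (algebraMap A F) % p.map (algebraMap A F) = 0 := by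
      rw [hz, Polynomial.map_zero] at hmod
      exact (smul_eq_zero.mp hmod.symm).resolve_left hc0
    exact (EuclideanDomain.mod_eq_zero).mp this
  have hu : IsUnit p.leadingCoeff := by
    obtain ⟨r, hr⟩ := hdvd q₀ hq₀'
    have := congrArg leadingCoeff hr
    rw [hq₀m.leadingCoeff, leadingCoeff_mul] at this
    exact IsUnit.of_mul_eq_one _ this.symm
  have hker : RingHom.ker (Polynomial.aeval (R := A) y) =
      Ideal.span {Polynomial.C (hu.unit⁻¹ : Aˣ).1 * p} := by
    have hass : Associated p (Polynomial.C (hu.unit⁻¹ : Aˣ).1 * p) := by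
      obtain ⟨u, hu'⟩ := (hu.unit⁻¹ : Aˣ).isUnit.map (Polynomial.C : A →+* A[X])
      exact ⟨u, by rw [hu', mul_comm]⟩
    rw [← Ideal.span_singleton_eq_span_singleton.mpr hass]
    ext q
    rw [RingHom.mem_ker, Ideal.mem_span_singleton]
    refine ⟨hdvd q, ?_⟩
    rintro ⟨r, rfl⟩
    rw [map_mul]
    exact (congrArg (· * _) hpy).trans (zero_mul _)
  have hmon : (Polynomial.C (hu.unit⁻¹ : Aˣ).1 * p).Monic := by
    rw [Polynomial.Monic, Polynomial.leadingCoeff_mul, Polynomial.leadingCoeff_C]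
    exact hu.val_inv_mul
  have hfree := hmon.free_quotient
  rw [← hker] at hfree
  exact Module.Free.of_equiv (Ideal.quotientKerAlgEquivOfSurjective hsurj).toLinearEquiv

theorem tf_of_nondeg (φ : M →ₗ[A] A) (hnd : ∀ m, (∀ z, φ (m * z) = 0) → m = 0)
    (a : A) (m : M) (h : a • m = 0) : a = 0 ∨ m = 0 := by
  by_cases ha : a = 0
  · exact Or.inl ha
  · refine Or.inr (hnd m fun z => ?_)
    have : a * φ (m * z) = 0 := by
      rw [← smul_eq_mul, ← map_smul, ← smul_mul_assoc, h, zero_mul, map_zero]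
    exact (mul_eq_zero.mp this).resolve_left ha

theorem case_one [Module.Finite A M] (φ : M →ₗ[A] A) (hnd : ∀ m, (∀ z, φ (m * z) = 0) → m = 0)
    (hrk : ∀ v : Fin 4 → M, ∃ a : Fin 4 → A, a ≠ 0 ∧ ∑ i, a i • v i = 0)
    (x y : M) (hxy : Algebra.adjoin A {x, y} = ⊤) (h1 : φ 1 = 0) (hx : φ x = 0) (hy : φ y = 1)
    (hxy0 : φ (x * y) = 0) (hl : φ (x * x) = 0 ∨ Prime (φ (x * x))) : Module.Free A M := by
  have htf := tf_of_nondeg φ hnd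
  set l := φ (x * x) with hldef
  -- relation analysis
  have key : ∀ z : M, φ z = 0 → φ (y * z) = 0 → ∃ a b : A, (a ≠ 0 ∨ b ≠ 0) ∧ a • x + b • z = 0 := by
    intro z hz hyz
    obtain ⟨a, ha, hs⟩ := hrk ![1, x, y, z]
    simp only [Fin.sum_univ_four, Matrix.cons_val_zero, Matrix.cons_val_one,
      Matrix.cons_val] at hs
    have e2 : a 2 = 0 := by
      have := congrArg φ hs
      simpa [h1, hx, hy, hz] using this
    have e0 : a 0 = 0 := by
      have := congrArg (fun m => φ (y * m)) hs
      simp only [mul_add, mul_smul_comm, map_add, map_smul, mul_one, hy, mul_comm y x, hxy0, hyz,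
        e2, zero_smul] at this
      simpa using this
    refine ⟨a 1, a 3, ?_, ?_⟩
    · by_contra hcon
      push Not at hcon
      apply ha
      funext i
      fin_cases i <;> simp [e0, e2, hcon.1, hcon.2]
    · simpa [e0, e2] using hs
  have red : ∀ z : M, ∃ c d : A, φ (z - c • y - d • 1) = 0 ∧ φ (y * (z - c • y - d • 1)) = 0 := by
    intro z
    refine ⟨φ z, φ (y * z) - φ z * φ (y * y), ?_, ?_⟩
    · simp [h1, hy]
    · simp only [mul_sub, mul_smul_comm, map_sub, map_smul, mul_one, hy, smul_eq_mul]
      ring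
  rcases hl with hl | hl
  · have hx0 : x = 0 := by
      apply hnd
      intro z
      obtain ⟨c, d, e1, e2⟩ := red z
      set z' := z - c • y - d • (1 : M) with hz'
      have hxz : φ (x * z) = φ (x * z') := by
        rw [hz']
        simp [mul_sub, hxy0, hx]
      obtain ⟨a, b, hab, hrel⟩ := key z' e1 e2
      by_cases hb : b = 0
      · rw [hb, zero_smul, add_zero] at hrel
        have ha : a ≠ 0 := hab.resolve_right (fun h => h hb)
        rw [(htf _ _ hrel).resolve_left ha, zero_mul, map_zero]
      · have := congrArg (fun m => φ (x * m)) hrel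
        simp only [mul_add, mul_smul_comm, map_add, map_smul, smul_eq_mul, mul_zero, map_zero] at this
        rw [← hldef, hl, mul_zero, zero_add] at this
        rw [hxz]
        exact (mul_eq_zero.mp this).resolve_left hb
    apply free_of_one_gen htf y
    rw [← hxy, hx0]
    apply le_antisymm
    · exact Algebra.adjoin_mono (by simp)
    · apply Algebra.adjoin_le
      rintro w (rfl | rfl)
      · exact Subalgebra.zero_mem _
      · exact Algebra.subset_adjoin rfl
  · have hspan : ∀ z : M, ∃ c d e : A, z = d • 1 + e • x + c • y := by
      intro z
      obtain ⟨c, d, e1, e2⟩ := red z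
      set z' := z - c • y - d • (1 : M) with hz'
      obtain ⟨a, b, hab, hrel⟩ := key z' e1 e2
      set t := φ (x * z') with ht
      have hr : a * l + b * t = 0 := by
        have := congrArg (fun m => φ (x * m)) hrel
        simpa only [mul_add, mul_smul_comm, map_add, map_smul, smul_eq_mul, mul_zero, map_zero]
          using this
      have hb : b ≠ 0 := by
        intro hb
        rw [hb, zero_mul, add_zero] at hr
        exact hab.elim (fun h => h ((mul_eq_zero.mp hr).resolve_right hl.ne_zero)) (fun h => h hb)
      have hw : l • z' = t • x := by
        have : b • (l • z' - t • x) = 0 := by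
          have e : b • (l • z' - t • x) = l • (a • x + b • z') - (a * l + b * t) • x := by
            module
          rw [e, hrel, hr]; simp
        exact sub_eq_zero.mp ((htf _ _ this).resolve_left hb)
      have hdv : l ∣ t * t := by
        have := congrArg (fun m => φ (m * z')) hw
        simp only [smul_mul_assoc, map_smul, smul_eq_mul] at this
        exact ⟨_, this.symm⟩
      obtain ⟨t', ht'⟩ : l ∣ t := by
        rcases hl.dvd_or_dvd hdv with h | h <;> exact h
      have hz2 : z' = t' • x := by
        have : l • (z' - t' • x) = 0 := by rw [smul_sub, hw, ht', mul_smul, sub_self]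
        exact sub_eq_zero.mp ((htf _ _ this).resolve_left hl.ne_zero)
      refine ⟨c, d, t', ?_⟩
      rw [← hz2, hz']; abel
    have hli : LinearIndependent A ![(1 : M), x, y] := by
      rw [Fintype.linearIndependent_iff]
      intro g hg
      simp only [Fin.sum_univ_three, Matrix.cons_val_zero, Matrix.cons_val_one,
        Matrix.cons_val] at hg
      have e2 : g 2 = 0 := by
        have := congrArg φ hg
        simpa [h1, hx, hy] using this
      have e0 : g 0 = 0 := by
        have := congrArg (fun m => φ (y * m)) hg
        simp only [mul_add, mul_smul_comm, map_add, map_smul, mul_one, hy, mul_comm y x, hxy0,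
          e2, zero_smul] at this
        simpa using this
      have e1 : g 1 = 0 := by
        have := congrArg (fun m => φ (x * m)) hg
        simp only [mul_add, mul_smul_comm, map_add, map_smul, mul_one, hx,
          e2, zero_smul] at this
        simpa [← hldef, hl.ne_zero] using this
      intro i
      fin_cases i <;> simp [e0, e1, e2]
    have hsp : ⊤ ≤ Submodule.span A (Set.range ![(1 : M), x, y]) := by
      intro z _
      obtain ⟨c, d, e, rfl⟩ := hspan z
      have m0 : ∀ i, ![(1 : M), x, y] i ∈ Submodule.span A (Set.range ![(1 : M), x, y]) :=
        fun i => Submodule.subset_span ⟨i, rfl⟩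
      exact add_mem (add_mem (Submodule.smul_mem _ _ (m0 0)) (Submodule.smul_mem _ _ (m0 1)))
        (Submodule.smul_mem _ _ (m0 2))
    exact Module.Free.of_basis (Module.Basis.mk hli hsp)

theorem case_one_gen {k : Type} [Field k] [Algebra k A] [Module.Finite A M] (φ : M →ₗ[A] A)
    (hnd : ∀ m, (∀ z, φ (m * z) = 0) → m = 0)
    (hrk : ∀ v : Fin 4 → M, ∃ a : Fin 4 → A, a ≠ 0 ∧ ∑ i, a i • v i = 0)
    (V : Submodule k A) (hV : ∀ v ∈ V, v = 0 ∨ Prime v)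
    (x y : M) (hxy : Algebra.adjoin A {x, y} = ⊤) (h1 : φ 1 = 0)
    (c₀ c₁ : k) (hx : φ x = algebraMap k A c₀) (hy : φ y = algebraMap k A c₁) (hc : c₁ ≠ 0)
    (hxx : φ (x * x) ∈ V) (hxyV : φ (x * y) ∈ V) (hyy : φ (y * y) ∈ V) : Module.Free A M := by
  set i : k →+* A := algebraMap k A with hi
  set y' : M := i c₁⁻¹ • y with hy'
  set x₀ : M := x - i c₀ • y' with hx₀
  have hic : i c₁ * i c₁⁻¹ = 1 := by rw [hi, ← map_mul, mul_inv_cancel₀ hc, map_one]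
  have hy1 : φ y' = 1 := by rw [hy', map_smul, hy, smul_eq_mul, mul_comm, hic]
  have hx1 : φ x₀ = 0 := by rw [hx₀, map_sub, map_smul, hy1, hx]; simp [hi]
  set x' : M := x₀ - φ (x₀ * y') • 1 with hx'
  apply case_one φ hnd hrk x' y' _ h1
  · rw [hx', map_sub, map_smul, h1, hx1]; simp
  · exact hy1
  · rw [hx', sub_mul, map_sub, smul_mul_assoc, one_mul, map_smul, hy1]; simp
  · apply hV
    have e1 : φ (x' * x') = φ (x₀ * x₀) := by
      have : x' * x' = x₀ * x₀ - φ (x₀ * y') • x₀ - φ (x₀ * y') • x' := by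
        rw [hx', sub_mul, mul_sub, sub_mul]
        simp only [smul_mul_assoc, mul_smul_comm, one_mul, mul_one]
      rw [this]
      simp [hx1, hx', h1]
    have e2 : φ (x₀ * x₀) = φ (x * x) - (2 * (c₀ * c₁⁻¹)) • φ (x * y)
        + (c₀ * c₁⁻¹) ^ 2 • φ (y * y) := by
      have hs : ∀ (c : k) (a : A), c • a = i c * a := fun c a => Algebra.smul_def c a
      have : x₀ * x₀ = x * x - i (2 * (c₀ * c₁⁻¹)) • (x * y) + i ((c₀ * c₁⁻¹) ^ 2) • (y * y) := by
        rw [hx₀, hy', hi]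
        simp only [Algebra.smul_def, map_mul, map_pow, map_ofNat]
        ring
      rw [this, map_add, map_sub, map_smul, map_smul, hs, hs]
      simp
    rw [e1, e2]
    exact V.add_mem (V.sub_mem hxx (V.smul_mem _ hxyV)) (V.smul_mem _ hyy)
  · rw [eq_top_iff, ← hxy]
    apply Algebra.adjoin_le
    have my' : y' ∈ Algebra.adjoin A {x', y'} := Algebra.subset_adjoin (by simp)
    have mx' : x' ∈ Algebra.adjoin A {x', y'} := Algebra.subset_adjoin (by simp)
    have ex : x = x' + φ (x₀ * y') • 1 + i c₀ • y' := by rw [hx', hx₀]; abel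
    have ey : y = i c₁ • y' := by rw [hy', smul_smul, hic, one_smul]
    rintro w (rfl | rfl)
    · have := add_mem (add_mem mx' (Subalgebra.smul_mem _ (one_mem _) (φ (x₀ * y'))))
        (Subalgebra.smul_mem _ my' (i c₀))
      rw [← ex] at this
      exact this
    · have := Subalgebra.smul_mem _ my' (i c₁)
      rw [← ey] at this
      exact this

theorem case_two [Module.Finite A M] (φ : M →ₗ[A] A)
    (hnd : ∀ m, (∀ z, φ (m * z) = 0) → m = 0)
    (hrk : ∀ v : Fin 4 → M, ∃ a : Fin 4 → A, a ≠ 0 ∧ ∑ i, a i • v i = 0)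
    (x y : M) (hxy : Algebra.adjoin A {x, y} = ⊤) (h1 : φ 1 = 0) (hx : φ x = 0) (hy : φ y = 0)
    (hxx : φ (x * x) = 0 ∨ Prime (φ (x * x)))
    (α β γ : A) (hγ : γ ≠ 0) (hrel : α • (1 : M) + β • x + γ • y = 0) : Module.Free A M := by
  have htf := tf_of_nondeg φ hnd
  by_cases hM : (1 : M) = 0
  · have : Subsingleton M := ⟨fun a b => by rw [← mul_one a, ← mul_one b, hM]; simp⟩
    exact Module.Free.of_subsingleton A M
  rcases hxx with h0 | hp
  · exfalso
    apply hM
    apply hnd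
    have hpow : ∀ n, φ (x ^ n) = 0 := by
      intro n
      induction n using Nat.strong_induction_on with
      | _ n ih =>
        by_cases hn : n < 3
        · interval_cases n
          · simpa using h1
          · simpa using hx
          · simpa [pow_two] using h0
        · obtain ⟨a, ha, hs⟩ := hrk ![1, x, x ^ 2, x ^ 3]
          simp only [Fin.sum_univ_four, Matrix.cons_val_zero, Matrix.cons_val_one,
            Matrix.cons_val] at hs
          have hmul : ∀ j, a 0 * φ (x ^ j) + a 1 * φ (x ^ (j + 1)) + a 2 * φ (x ^ (j + 2))
              + a 3 * φ (x ^ (j + 3)) = 0 := by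
            intro j
            have := congrArg (fun m => φ (x ^ j * m)) hs
            simp only [mul_add, mul_smul_comm, map_add, map_smul, smul_eq_mul, mul_zero,
              map_zero, mul_one, ← pow_succ, ← pow_add] at this
            exact this
          by_cases a3 : a 3 = 0
          · by_cases a2 : a 2 = 0
            · by_cases a1 : a 1 = 0
              · have a0 : a 0 ≠ 0 := by
                  intro a0
                  apply ha
                  funext i
                  fin_cases i <;> simp [a0, a1, a2, a3]
                have := hmul n
                simpa [a1, a2, a3, a0] using this
              · have := hmul (n - 1)
                rw [ih (n - 1) (by omega), show n - 1 + 1 = n by omega] at this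
                simpa [a1, a2, a3] using this
            · have := hmul (n - 2)
              rw [ih (n - 2) (by omega), ih (n - 2 + 1) (by omega),
                show n - 2 + 2 = n by omega] at this
              simpa [a2, a3] using this
          · have := hmul (n - 3)
            rw [ih (n - 3) (by omega), ih (n - 3 + 1) (by omega), ih (n - 3 + 2) (by omega),
              show n - 3 + 3 = n by omega] at this
            simpa [a3] using this
    have hadj : ∀ z ∈ Algebra.adjoin A {x}, φ z = 0 := by
      intro z hz
      rw [Algebra.adjoin_singleton_eq_range_aeval] at hz
      obtain ⟨p, rfl⟩ := hz
      change φ (Polynomial.aeval x p) = 0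
      rw [Polynomial.aeval_eq_sum_range, map_sum]
      exact Finset.sum_eq_zero fun i _ => by rw [map_smul, hpow, smul_zero]
    have hall : ∀ z ∈ Algebra.adjoin A {x, y}, ∃ c : A, c ≠ 0 ∧ c • z ∈ Algebra.adjoin A {x} := by
      intro z hz
      have mx : x ∈ Algebra.adjoin A {x} := Algebra.subset_adjoin rfl
      induction hz using Algebra.adjoin_induction with
      | mem w hw =>
        rcases hw with rfl | rfl
        · exact ⟨1, one_ne_zero, by simpa using mx⟩
        · refine ⟨γ, hγ, ?_⟩
          have : γ • w = -(α • (1 : M) + β • x) := by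
            rw [eq_neg_iff_add_eq_zero, add_comm]; exact hrel
          rw [this]
          exact neg_mem (add_mem (Subalgebra.smul_mem _ (one_mem _) _)
            (Subalgebra.smul_mem _ mx _))
      | algebraMap r => exact ⟨1, one_ne_zero, by simp [Subalgebra.algebraMap_mem]⟩
      | add u v _ _ hu hv =>
        obtain ⟨c, hc, hcu⟩ := hu
        obtain ⟨d, hd, hdv⟩ := hv
        refine ⟨c * d, mul_ne_zero hc hd, ?_⟩
        have : (c * d) • (u + v) = d • (c • u) + c • (d • v) := by module
        rw [this]
        exact add_mem (Subalgebra.smul_mem _ hcu _) (Subalgebra.smul_mem _ hdv _)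
      | mul u v _ _ hu hv =>
        obtain ⟨c, hc, hcu⟩ := hu
        obtain ⟨d, hd, hdv⟩ := hv
        refine ⟨c * d, mul_ne_zero hc hd, ?_⟩
        rw [← smul_mul_smul_comm]
        exact mul_mem hcu hdv
    intro z
    rw [one_mul]
    obtain ⟨c, hc, hcz⟩ := hall z (by rw [hxy]; trivial)
    have := hadj _ hcz
    rw [map_smul, smul_eq_mul] at this
    exact (mul_eq_zero.mp this).resolve_left hc
  · set a := φ (x * x) with ha
    set b := φ (x * y) with hb
    set c := φ (y * y) with hc
    have r1 : β * a + γ * b = 0 := by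
      have := congrArg (fun m => φ (x * m)) hrel
      simp only [mul_add, mul_smul_comm, map_add, map_smul, smul_eq_mul, mul_zero,
        map_zero, mul_one, hx, zero_add] at this
      exact this
    have r2 : β * b + γ * c = 0 := by
      have := congrArg (fun m => φ (y * m)) hrel
      simp only [mul_add, mul_smul_comm, map_add, map_smul, smul_eq_mul, mul_zero,
        map_zero, mul_one, hy, zero_add, mul_comm y x] at this
      exact this
    have r3 : a * c = b * b := by
      have : γ * (a * c - b * b) = 0 := by linear_combination a * r2 - b * r1
      exact sub_eq_zero.mp ((mul_eq_zero.mp this).resolve_left hγ)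
    obtain ⟨s, hs⟩ : a ∣ b := by
      rcases hp.dvd_or_dvd (⟨c, r3.symm⟩ : a ∣ b * b) with h | h <;> exact h
    have hβ : β = -(γ * s) := by
      have : a * (β + γ * s) = 0 := by linear_combination r1 - γ * hs
      exact eq_neg_of_add_eq_zero_left ((mul_eq_zero.mp this).resolve_left hp.ne_zero)
    set w := y - s • x with hw
    have hγw : γ • w = algebraMap A M (-α) := by
      rw [Algebra.algebraMap_eq_smul_one]
      have : γ • w - (-α) • (1 : M) = 0 := by
        rw [← hrel, hβ, hw]; module
      exact sub_eq_zero.mp this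
    obtain ⟨p, hpm, hpw⟩ := (Algebra.IsIntegral.of_finite A M).isIntegral w
    have h2 : Polynomial.aeval (γ • w) (p.scaleRoots γ) = 0 := by
      rw [Algebra.smul_def]
      exact Polynomial.scaleRoots_aeval_eq_zero hpw
    rw [hγw, Polynomial.aeval_algebraMap_apply] at h2
    have h3 : Polynomial.aeval (-α) (p.scaleRoots γ) = 0 := by
      rw [Algebra.algebraMap_eq_smul_one] at h2
      exact (htf _ _ h2).resolve_right hM
    let F := FractionRing A
    have hinj : Function.Injective (algebraMap A F) := IsFractionRing.injective A F
    have hγF : algebraMap A F γ ≠ 0 := by simpa using hγ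
    have h4 : Polynomial.eval₂ (algebraMap A F) (algebraMap A F γ * (algebraMap A F (-α) / algebraMap A F γ))
        (p.scaleRoots γ) = 0 := by
      rw [mul_div_cancel₀ _ hγF, Polynomial.eval₂_at_apply]
      rw [Polynomial.coe_aeval_eq_eval] at h3
      rw [h3, map_zero]
    rw [Polynomial.scaleRoots_eval₂_mul] at h4
    have h5 := (mul_eq_zero.mp h4).resolve_left (pow_ne_zero _ hγF)
    obtain ⟨δ, hδ⟩ := (IsIntegrallyClosed.isIntegral_iff (R := A)
      (x := algebraMap A F (-α) / algebraMap A F γ)).mp ⟨p, hpm, h5⟩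
    have h6 : γ * δ = -α := by
      apply hinj
      rw [map_mul, hδ, mul_div_cancel₀ _ hγF]
    have h7 : w = δ • 1 := by
      have : γ • (w - δ • (1 : M)) = 0 := by
        rw [smul_sub, hγw, smul_smul, h6, Algebra.algebraMap_eq_smul_one, sub_self]
      exact sub_eq_zero.mp ((htf _ _ this).resolve_left hγ)
    apply free_of_one_gen htf x
    rw [eq_top_iff, ← hxy]
    apply Algebra.adjoin_le
    have mx : x ∈ Algebra.adjoin A {x} := Algebra.subset_adjoin rfl
    rintro v (rfl | rfl)
    · exact mx
    · have e : v = δ • 1 + s • x := by rw [← h7, hw]; abel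
      have := add_mem (Subalgebra.smul_mem _ (one_mem (Algebra.adjoin A {x})) δ)
        (Subalgebra.smul_mem _ mx s)
      rw [← e] at this
      exact this

/-- Main structural result: the algebra `M` is free over `A`. -/
theorem free_main {k : Type} [Field k] [Algebra k A] [Module.Finite A M] (φ : M →ₗ[A] A)
    (hnd : ∀ m, (∀ z, φ (m * z) = 0) → m = 0)
    (hrk : ∀ v : Fin 4 → M, ∃ a : Fin 4 → A, a ≠ 0 ∧ ∑ i, a i • v i = 0)
    (V : Submodule k A) (hV : ∀ v ∈ V, v = 0 ∨ Prime v)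
    (x y : M) (hxy : Algebra.adjoin A {x, y} = ⊤) (h1 : φ 1 = 0)
    (c₀ c₁ : k) (hx : φ x = algebraMap k A c₀) (hy : φ y = algebraMap k A c₁)
    (hxx : φ (x * x) ∈ V) (hxyV : φ (x * y) ∈ V) (hyy : φ (y * y) ∈ V) : Module.Free A M := by
  have hyx : Algebra.adjoin A {y, x} = ⊤ := by rwa [Set.pair_comm]
  by_cases hc₁ : c₁ = 0
  · by_cases hc₀ : c₀ = 0
    · rw [hc₀, map_zero] at hx
      rw [hc₁, map_zero] at hy
      have htf := tf_of_nondeg φ hnd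
      by_cases hM : (1 : M) = 0
      · have : Subsingleton M := ⟨fun a b => by rw [← mul_one a, ← mul_one b, hM]; simp⟩
        exact Module.Free.of_subsingleton A M
      have hφ : ∃ z, φ z ≠ 0 := by
        by_contra hcon
        push Not at hcon
        exact hM (hnd 1 fun z => hcon _)
      obtain ⟨z, hz⟩ := hφ
      obtain ⟨a, ha, hs⟩ := hrk ![1, x, y, z]
      simp only [Fin.sum_univ_four, Matrix.cons_val_zero, Matrix.cons_val_one,
        Matrix.cons_val] at hs
      have a3 : a 3 = 0 := by
        have := congrArg φ hs
        simpa [h1, hx, hy, hz] using this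
      rw [a3, zero_smul, add_zero] at hs
      by_cases a2 : a 2 = 0
      · have a1 : a 1 ≠ 0 := by
          intro a1
          rw [a1, a2] at hs
          have a0 : a 0 = 0 := by
            simp only [zero_smul, add_zero] at hs
            exact (htf _ _ hs).resolve_right hM
          apply ha
          funext i
          fin_cases i <;> simp [a0, a1, a2, a3]
        exact case_two φ hnd hrk y x hyx h1 hy hx (hV _ hyy) (a 0) (a 2) (a 1) a1
          (by rw [← hs]; abel)
      · exact case_two φ hnd hrk x y hxy h1 hx hy (hV _ hxx) (a 0) (a 1) (a 2) a2 hs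
    · exact case_one_gen φ hnd hrk V hV y x hyx h1 c₁ c₀ hy hx hc₀ hyy (by rwa [mul_comm]) hxx
  · exact case_one_gen φ hnd hrk V hV x y hxy h1 c₀ c₁ hx hy hc₁ hxx hxyV hyy

end P4
end C3


namespace C3
section P5a
variable {C : Type 1} [Category.{0} C] [Abelian C]

open Limits

def resπ {X : C} (Q : ProjectiveResolution X) : Q.complex.X 0 ⟶ X := Q.π.f 0

theorem resπ_epi {X : C} (Q : ProjectiveResolution X) : Epi (resπ Q) :=
  (inferInstance : Epi (Q.π.f 0))

theorem resπ_w {X : C} (Q : ProjectiveResolution X) : Q.complex.d 1 0 ≫ resπ Q = 0 :=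
  Q.complex_d_comp_π_f_zero

theorem resπ_exact {X : C} (Q : ProjectiveResolution X) :
  (ShortComplex.mk (Q.complex.d 1 0) (resπ Q) (resπ_w Q)).Exact := Q.exact₀

theorem aug_exact_one (S : ShortComplex C) (hS : S.ShortExact) (Q : ProjectiveResolution S.X₁)
    (w : Q.complex.d 1 0 ≫ (resπ Q ≫ S.f) = 0) :
    (ShortComplex.mk (Q.complex.d 1 0) (resπ Q ≫ S.f) w).Exact := by
  have := hS.mono_f
  have h := resπ_exact Q
  rw [ShortComplex.exact_iff_exact_up_to_refinements] at h ⊢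
  intro B x hx
  simp only at hx
  rw [← Category.assoc] at hx
  exact h x (zero_of_comp_mono _ hx)

theorem aug_exact_zero (S : ShortComplex C) (hS : S.ShortExact) (Q : ProjectiveResolution S.X₁)
    (w : (resπ Q ≫ S.f) ≫ S.g = 0) :
    (ShortComplex.mk (resπ Q ≫ S.f) S.g w).Exact := by
  have h := hS.exact
  have hepi := resπ_epi Q
  rw [ShortComplex.exact_iff_exact_up_to_refinements] at h ⊢
  intro B x hx
  obtain ⟨B', p, hp, y, hy⟩ := h x hx
  obtain ⟨B'', p', hp', z, hz⟩ := surjective_up_to_refinements_of_epi (resπ Q) y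
  refine ⟨B'', p' ≫ p, epi_comp _ _, z, ?_⟩
  simp only [Category.assoc] at *
  rw [hy]
  rw [← Category.assoc, hz, Category.assoc]

theorem aug_w (S : ShortComplex C) (Q : ProjectiveResolution S.X₁) :
    Q.complex.d 1 0 ≫ (resπ Q ≫ S.f) = 0 := by
  rw [← Category.assoc, resπ_w, zero_comp]

def augC (S : ShortComplex C) (Q : ProjectiveResolution S.X₁) : ChainComplex C ℕ :=
  ChainComplex.augment Q.complex (resπ Q ≫ S.f) (aug_w S Q)

theorem augC_exactAt (S : ShortComplex C) (hS : S.ShortExact) (Q : ProjectiveResolution S.X₁)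
    (n : ℕ) : (augC S Q).ExactAt (n + 1) := by
  rw [HomologicalComplex.exactAt_iff' _ (n + 1 + 1) (n + 1) n (by simp) (by simp)]
  match n with
  | 0 => exact aug_exact_one S hS Q (aug_w S Q)
  | n + 1 => exact Q.exact_succ n

theorem augC_quasi (S : ShortComplex C) (hS : S.ShortExact) (Q : ProjectiveResolution S.X₁)
    (w : (augC S Q).d 1 0 ≫ S.g = 0) : 
    QuasiIso ((ChainComplex.toSingle₀Equiv (augC S Q) S.X₃).symm ⟨S.g, w⟩) := 
  ⟨fun n => by
    have := hS.epi_g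
    cases n
    · rw [ChainComplex.quasiIsoAt₀_iff, ShortComplex.quasiIso_iff_of_zeros']
      · refine (ShortComplex.exact_and_epi_g_iff_of_iso ?_).2
          ⟨aug_exact_zero S hS Q w, by dsimp; infer_instance⟩
        exact ShortComplex.isoMk (Iso.refl _) (Iso.refl _) (Iso.refl _)
          ((Category.id_comp _).trans (Category.comp_id _).symm)
          ((Category.id_comp _).trans ((ChainComplex.toSingle₀Equiv_symm_apply_f_zero
            (C := augC S Q) S.g w).symm.trans (Category.comp_id _).symm))
      all_goals rfl
    · rw [quasiIsoAt_iff_exactAt']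
      · apply augC_exactAt S hS
      · apply ChainComplex.exactAt_succ_single_obj⟩

def augRes (S : ShortComplex C) (hS : S.ShortExact) (hp : Projective S.X₂)
    (Q : ProjectiveResolution S.X₁) : ProjectiveResolution S.X₃ where
  complex := augC S Q
  projective n := by
    cases n
    · exact hp
    · exact Q.projective _
  π := (ChainComplex.toSingle₀Equiv (augC S Q) S.X₃).symm ⟨S.g, by
    exact (Category.assoc _ _ _).trans ((congrArg (resπ Q ≫ ·) S.zero).trans comp_zero)⟩
  quasiIso := augC_quasi S hS Q _

theorem exists_resolution [EnoughProjectives C] (n : ℕ) : ∀ (X : C) [HasProjectiveDimensionLE X n],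
    ∃ P : ProjectiveResolution X, ∀ i, n < i → Limits.IsZero (P.complex.X i) := by
  induction n with
  | zero =>
    intro X h
    have : Projective X := projective_iff_hasProjectiveDimensionLT_one.mpr h
    refine ⟨ProjectiveResolution.self X, fun i hi => ?_⟩
    obtain ⟨j, rfl⟩ : ∃ j, i = j + 1 := ⟨i - 1, by omega⟩
    exact HomologicalComplex.isZero_single_obj_X _ _ _ _ (by simp)
  | succ n ih =>
    intro X h
    let S : ShortComplex C := ShortComplex.mk (kernel.ι (Projective.π X)) (Projective.π X) (by simp)
    have hS : S.ShortExact := { exact := ShortComplex.exact_kernel _ }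
    have h1 : HasProjectiveDimensionLE S.X₁ n := by
      have : HasProjectiveDimensionLT S.X₃ (n + 2) := h
      exact (hS.hasProjectiveDimensionLT_X₃_iff n (Projective.projective_over X)).mp this
    obtain ⟨Q, hQ⟩ := ih S.X₁
    refine ⟨augRes S hS (Projective.projective_over X) Q, fun i hi => ?_⟩
    obtain ⟨j, rfl⟩ : ∃ j, i = j + 1 := ⟨i - 1, by omega⟩
    exact hQ j (by omega)

end P5a
end C3


namespace C3
section P5b

/-- projective dimension bound for a module -/
def PD (P : Type) [CommRing P] (X : Type) [AddCommGroup X] [Module P X] (n : ℕ) : Prop :=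
  HasProjectiveDimensionLE (ModuleCat.of P X) n

theorem PD.mono {P : Type} [CommRing P] {X : Type} [AddCommGroup X] [Module P X] {n m : ℕ}
    (h : PD P X n) (hnm : n ≤ m) : PD P X m := by
  have : HasProjectiveDimensionLT (ModuleCat.of P X) (n + 1) := h
  exact hasProjectiveDimensionLT_of_ge _ (n + 1) (m + 1) (by omega)

theorem PD.of_projective {P : Type} [CommRing P] {X : Type} [AddCommGroup X] [Module P X]
    [Module.Projective P X] : PD P X 0 := by
  have : Projective (ModuleCat.of P X) := (IsProjective.iff_projective (R := P) X).mp inferInstance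
  exact projective_iff_hasProjectiveDimensionLT_one.mp this

theorem PD.of_equiv {P : Type} [CommRing P] {X Y : Type} [AddCommGroup X] [Module P X]
    [AddCommGroup Y] [Module P Y] (e : X ≃ₗ[P] Y) {n : ℕ} (h : PD P X n) : PD P Y n := by
  have : HasProjectiveDimensionLE (ModuleCat.of P X) n := h
  exact ModuleCat.hasProjectiveDimensionLE_of_linearEquiv (M := ModuleCat.of P X)
    (N := ModuleCat.of P Y) e n

theorem PD.ses {P : Type} [CommRing P] {X Y Z : Type} [AddCommGroup X] [Module P X]
    [AddCommGroup Y] [Module P Y] [AddCommGroup Z] [Module P Z] (i : X →ₗ[P] Y) (p : Y →ₗ[P] Z)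
    (hi : Function.Injective i) (hp : Function.Surjective p) (h : Function.Exact i p) {n : ℕ}
    (hX : PD P X n) (hY : PD P Y (n + 1)) : PD P Z (n + 1) := by
  let S : ShortComplex (ModuleCat P) := ShortComplex.mk (ModuleCat.ofHom i) (ModuleCat.ofHom p)
    (by rw [← ModuleCat.ofHom_comp, h.linearMap_comp_eq_zero]; rfl)
  have hS : S.ShortExact :=
    { exact := (ShortComplex.ShortExact.moduleCat_exact_iff_function_exact _).mpr h
      mono_f := (ModuleCat.mono_iff_injective _).mpr hi
      epi_g := (ModuleCat.epi_iff_surjective _).mpr hp }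
  exact hS.hasProjectiveDimensionLT_X₃ (n + 1) hX hY

theorem PD.koszul {P E : Type} [CommRing P] [CommRing E] [Algebra P E] [Module.Projective P E]
    (f g : E) (hf : ∀ u, f * u = 0 → u = 0) (hg : ∀ u, f ∣ g * u → f ∣ u) :
    PD P (E ⧸ Ideal.span {f, g}) 2 := by
  have h1 : PD P (E ⧸ Ideal.span {f}) 1 := by
    refine PD.ses (X := E) (Y := E) (LinearMap.mulLeft P f)
      (Ideal.Quotient.mkₐ P (Ideal.span {f})).toLinearMap ?_ Ideal.Quotient.mk_surjective ?_
      PD.of_projective (PD.of_projective.mono (by omega))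
    · rw [injective_iff_map_eq_zero]
      exact hf
    · intro u
      change (Ideal.Quotient.mk _ u = 0) ↔ _
      rw [Ideal.Quotient.eq_zero_iff_mem, Ideal.mem_span_singleton]
      exact ⟨fun ⟨v, hv⟩ => ⟨v, hv.symm⟩, fun ⟨v, hv⟩ => ⟨v, hv.symm⟩⟩
  have hle : Ideal.span {f} ≤ Ideal.span {f, g} := Ideal.span_mono (by simp)
  refine PD.ses (LinearMap.mulLeft P (Ideal.Quotient.mk (Ideal.span {f}) g))
      (Ideal.Quotient.factorₐ P hle).toLinearMap ?_
      (Ideal.Quotient.factor_surjective hle) ?_ h1 (h1.mono (by omega))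
  · rw [injective_iff_map_eq_zero]
    intro u
    obtain ⟨u, rfl⟩ := Ideal.Quotient.mk_surjective u
    change Ideal.Quotient.mk _ g * _ = 0 → _
    rw [← map_mul, Ideal.Quotient.eq_zero_iff_mem, Ideal.Quotient.eq_zero_iff_mem,
      Ideal.mem_span_singleton, Ideal.mem_span_singleton]
    exact hg u
  · intro u
    obtain ⟨u, rfl⟩ := Ideal.Quotient.mk_surjective u
    change (Ideal.Quotient.mk _ u = 0) ↔ _
    rw [Ideal.Quotient.eq_zero_iff_mem, Ideal.mem_span_pair]
    constructor
    · rintro ⟨a, b, rfl⟩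
      refine ⟨Ideal.Quotient.mk _ b, ?_⟩
      change Ideal.Quotient.mk _ g * _ = _
      rw [← map_mul, Ideal.Quotient.eq, Ideal.mem_span_singleton]
      exact ⟨-a, by ring⟩
    · rintro ⟨b, hb⟩
      obtain ⟨b, rfl⟩ := Ideal.Quotient.mk_surjective b
      change Ideal.Quotient.mk _ g * _ = _ at hb
      rw [← map_mul, Ideal.Quotient.eq, Ideal.mem_span_singleton] at hb
      obtain ⟨a, ha⟩ := hb
      exact ⟨-a, b, by linear_combination ha⟩

theorem projective_twist {P E : Type} [CommRing P] [CommRing E] (s t : P →+* E)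
    (σ σ' : E →+* E) (h1 : ∀ e, σ (σ' e) = e) (h2 : ∀ e, σ' (σ e) = e) (hst : ∀ p, σ (s p) = t p)
    (h : @Module.Projective P _ E _ s.toAlgebra.toModule) :
    @Module.Projective P _ E _ t.toAlgebra.toModule := by
  let e : @LinearEquiv P P _ _ (RingHom.id P) (RingHom.id P) _ _ E E _ _ s.toAlgebra.toModule
      t.toAlgebra.toModule :=
    @LinearEquiv.mk P P _ _ (RingHom.id P) (RingHom.id P) _ _ E E _ _ s.toAlgebra.toModule
      t.toAlgebra.toModule
      (@LinearMap.mk P P _ _ (RingHom.id P) E E _ _ s.toAlgebra.toModule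
        t.toAlgebra.toModule ⟨σ, map_add σ⟩ (fun p v => by
          change σ (s p * v) = t p * σ v
          rw [map_mul, hst])) σ' h2 h1
  letI m1 : Module P E := s.toAlgebra.toModule
  have := h
  exact @Module.Projective.of_equiv P P _ _ E E _ _ m1 t.toAlgebra.toModule
    (RingHom.id P) (RingHom.id P) _ _ e h

theorem PD.of_data {P E M : Type} [CommRing P] [CommRing E] [AddCommGroup M] [Module P M]
    (t : P →+* E) (hproj : @Module.Projective P _ E _ t.toAlgebra.toModule)
    (f g : E) (hf : ∀ u, f * u = 0 → u = 0) (hg : ∀ u, f ∣ g * u → f ∣ u)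
    (π : E →+ M) (hπ : ∀ p e, π (t p * e) = p • π e) (hs : Function.Surjective π)
    (hker : ∀ e, e ∈ Ideal.span {f, g} ↔ π e = 0) : PD P M 2 := by
  letI : Algebra P E := t.toAlgebra
  refine (PD.koszul (P := P) f g hf hg).of_equiv ?_
  let π' : E →ₗ[P] M :=
    { toFun := π
      map_add' := map_add π
      map_smul' := hπ }
  have hk : (Ideal.span {f, g}).restrictScalars P = LinearMap.ker π' := by
    ext e
    exact hker e
  exact (Submodule.quotEquivOfEq _ _ hk).trans (π'.quotKerEquivOfSurjective hs)

theorem free_mv {A M : Type} [CommRing A] [CommRing M] [Algebra A M] [Module.Free A M] :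
    @Module.Projective (MvPolynomial (Fin 2) A) _ (MvPolynomial (Fin 2) M) _
      (MvPolynomial.map (algebraMap A M)).toAlgebra.toModule := by
  letI := algebraMvPolynomial (σ := Fin 2) (R := A) (S := M)
  have h : Algebra.IsPushout A (MvPolynomial (Fin 2) A) M (MvPolynomial (Fin 2) M) :=
    inferInstance
  have hfree := IsBaseChange.free h.out
  exact @Module.Projective.of_free _ _ _ _ _ hfree

theorem PD.of_free_quot {A M : Type} [CommRing A] [CommRing M] [Algebra A M]
    [Module.Free A M] [Module (MvPolynomial (Fin 2) A) M] (x : Fin 2 → M)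
    (hx : ∀ (p : MvPolynomial (Fin 2) A) (m : M), p • m = aeval x p * m) :
    PD (MvPolynomial (Fin 2) A) M 2 := by
  -- the standard ring map
  let s : MvPolynomial (Fin 2) A →+* MvPolynomial (Fin 2) M := MvPolynomial.map (algebraMap A M)
  let t : MvPolynomial (Fin 2) A →+* MvPolynomial (Fin 2) M :=
    MvPolynomial.eval₂Hom (C.comp (algebraMap A M)) (fun i => X i + C (x i))
  let σ : MvPolynomial (Fin 2) M →+* MvPolynomial (Fin 2) M :=
    MvPolynomial.eval₂Hom C (fun i => X i + C (x i))
  let σ' : MvPolynomial (Fin 2) M →+* MvPolynomial (Fin 2) M :=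
    MvPolynomial.eval₂Hom C (fun i => X i - C (x i))
  have h1 : ∀ e, σ (σ' e) = e := fun e => by
    have : σ.comp σ' = RingHom.id _ := by
      apply MvPolynomial.ringHom_ext <;> intro i <;> simp [σ, σ']
    exact DFunLike.congr_fun this e
  have h2 : ∀ e, σ' (σ e) = e := fun e => by
    have : σ'.comp σ = RingHom.id _ := by
      apply MvPolynomial.ringHom_ext <;> intro i <;> simp [σ, σ']
    exact DFunLike.congr_fun this e
  have hst : ∀ p, σ (s p) = t p := fun p => by
    have : σ.comp s = t := by
      apply MvPolynomial.ringHom_ext <;> intro i <;> simp [σ, s, t]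
    exact DFunLike.congr_fun this p
  have hcc : ∀ p, constantCoeff (t p) = aeval x p := fun p => by
    have : (constantCoeff (R := M) (σ := Fin 2)).comp t = (aeval x : _ →ₐ[A] M) := by
      apply MvPolynomial.ringHom_ext <;> intro i <;> simp [t]
    exact DFunLike.congr_fun this p
  refine PD.of_data t (projective_twist s t σ σ' h1 h2 hst free_mv) (X 0) (X 1) ?_ ?_
    (constantCoeff (R := M) (σ := Fin 2)).toAddMonoidHom ?_ ?_ ?_
  · intro u hu
    exact (MvPolynomial.isRegular_X (R := M) (n := (0 : Fin 2))).left
      (show X 0 * u = X 0 * 0 by rw [hu, mul_zero])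
  · intro u hu
    rw [← Ideal.mem_span_singleton, ← Set.image_singleton, mem_ideal_span_X_image] at hu ⊢
    intro m hm
    obtain ⟨i, hi, hi'⟩ := hu (m + Finsupp.single 1 1) (by
      rw [mem_support_iff, mul_comm, coeff_mul_X]
      exact mem_support_iff.mp hm)
    refine ⟨i, hi, ?_⟩
    rw [Set.mem_singleton_iff] at hi
    subst hi
    simpa using hi'
  · intro p e
    change constantCoeff (t p * e) = _
    rw [map_mul, hcc, hx]
    rfl
  · exact fun m => ⟨C m, by simp⟩
  · intro e
    have : ({X 0, X 1} : Set (MvPolynomial (Fin 2) M)) = X '' Set.univ := by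
      ext v; simp [eq_comm]
    rw [this, mem_ideal_span_X_image]
    change _ ↔ constantCoeff e = 0
    rw [constantCoeff_eq]
    constructor
    · intro h
      by_contra hne
      obtain ⟨i, _, hi⟩ := h 0 (mem_support_iff.mpr hne)
      simp at hi
    · intro h m hm
      by_contra hcon
      push Not at hcon
      have : m = 0 := by ext i; simpa using hcon i trivial
      rw [this] at hm
      exact mem_support_iff.mp hm h

/-- transfer along the presentation of `I = (f₁,f₂,f₃)` -/
theorem PD.three {P : Type} [CommRing P] (f₁ f₂ f₃ : P)
    (hf : ∀ u, f₁ * u = 0 → u = 0) (hg : ∀ u, f₁ ∣ f₂ * u → f₁ ∣ u) (J : Ideal P)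
    (hJ : ∀ r, r ∈ J ↔ f₃ * r ∈ Ideal.span {f₁, f₂}) (h : PD P (P ⧸ J) 2) :
    PD P (P ⧸ Ideal.span {f₁, f₂, f₃}) 3 := by
  let i : (P ⧸ J) →ₗ[P] (P ⧸ Ideal.span {f₁, f₂}) :=
    Submodule.mapQ J (Ideal.span {f₁, f₂}) (LinearMap.mulLeft P f₃) (fun r hr => (hJ r).mp hr)
  have hi : ∀ r, i (Ideal.Quotient.mk J r) = Ideal.Quotient.mk _ (f₃ * r) := fun r => rfl
  have hle : Ideal.span {f₁, f₂} ≤ Ideal.span {f₁, f₂, f₃} := Ideal.span_mono (by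
      intro w hw; rcases hw with rfl | rfl <;> simp)
  refine PD.ses i (Ideal.Quotient.factorₐ P hle).toLinearMap ?_
      (Ideal.Quotient.factor_surjective hle) ?_ h ((PD.koszul f₁ f₂ hf hg).mono (by omega))
  · rw [injective_iff_map_eq_zero]
    intro u
    obtain ⟨u, rfl⟩ := Ideal.Quotient.mk_surjective u
    rw [hi, Ideal.Quotient.eq_zero_iff_mem, Ideal.Quotient.eq_zero_iff_mem]
    exact (hJ u).mpr
  · intro u
    obtain ⟨u, rfl⟩ := Ideal.Quotient.mk_surjective u
    change (Ideal.Quotient.mk _ u = 0) ↔ _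
    rw [Ideal.Quotient.eq_zero_iff_mem]
    have e : Ideal.span {f₁, f₂, f₃} = Ideal.span {f₁, f₂} ⊔ Ideal.span {f₃} := by
      rw [← Ideal.span_union]; congr 1; ext w; simp; tauto
    rw [e]
    constructor
    · intro hu
      obtain ⟨a, ha, b, hb, rfl⟩ := Submodule.mem_sup.mp hu
      obtain ⟨c, rfl⟩ := Ideal.mem_span_singleton.mp hb
      refine ⟨Ideal.Quotient.mk J c, ?_⟩
      rw [hi, Ideal.Quotient.eq]
      have : f₃ * c - (a + f₃ * c) = - a := by ring
      rw [this]
      exact neg_mem ha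
    · rintro ⟨b, hb⟩
      obtain ⟨b, rfl⟩ := Ideal.Quotient.mk_surjective b
      rw [hi, Ideal.Quotient.eq] at hb
      have : u = -(f₃ * b - u) + f₃ * b := by ring
      rw [this]
      exact add_mem (Ideal.mem_sup_left (neg_mem hb)) (Ideal.mem_sup_right
        (Ideal.mem_span_singleton.mpr ⟨b, rfl⟩))

attribute [local instance] RingHomInvPair.of_ringEquiv in
theorem PD.ringEquiv {P R : Type} [CommRing P] [CommRing R] (e : P ≃+* R) (I : Ideal P)
    {n : ℕ} (h : PD P (P ⧸ I) n) : PD R (R ⧸ I.map (e : P →+* R)) n := by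
  have : HasProjectiveDimensionLE (ModuleCat.of P (P ⧸ I)) n := h
  let q := Ideal.quotientEquiv I (I.map (e : P →+* R)) e rfl
  let e' : (P ⧸ I) ≃ₛₗ[RingHomClass.toRingHom e] (R ⧸ I.map (e : P →+* R)) :=
    { q with
      map_smul' := fun r m => by
        obtain ⟨m, rfl⟩ := Ideal.Quotient.mk_surjective m
        change q (Ideal.Quotient.mk I (r * m)) = _
        rw [map_mul, map_mul]
        rfl }
  exact ModuleCat.hasProjectiveDimensionLE_of_semiLinearEquiv
    (M := ModuleCat.of P (P ⧸ I)) (N := ModuleCat.of R (R ⧸ I.map (e : P →+* R))) e e' n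

end P5b
end C3


namespace C3
section P1a
variable {σ A : Type} [CommRing A]

/-- polynomials of total degree `< n` -/
def E (σ A : Type) [CommRing A] (n : ℕ) : Submodule A (MvPolynomial σ A) where
  carrier := {p | ∀ m : σ →₀ ℕ, n ≤ m.degree → coeff m p = 0}
  add_mem' := fun {p q} hp hq m hm => by rw [coeff_add, hp m hm, hq m hm, add_zero]
  zero_mem' := fun m hm => coeff_zero m
  smul_mem' := fun c p hp m hm => by rw [coeff_smul, hp m hm, smul_zero]

theorem mem_E {n : ℕ} {p : MvPolynomial σ A} :
    p ∈ E σ A n ↔ ∀ m : σ →₀ ℕ, n ≤ m.degree → coeff m p = 0 := Iff.rfl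

theorem E_mono {n m : ℕ} (h : n ≤ m) : E σ A n ≤ E σ A m := fun p hp d hd => hp d (h.trans hd)

theorem E_zero {p : MvPolynomial σ A} (h : p ∈ E σ A 0) : p = 0 := by
  ext m; exact h m (Nat.zero_le _)

theorem E_of_hom {p : MvPolynomial σ A} {n : ℕ} (h : p.IsHomogeneous n) : p ∈ E σ A (n + 1) :=
  fun m hm => h.coeff_eq_zero (by omega)

theorem E_exists (p : MvPolynomial σ A) : ∃ n, p ∈ E σ A n := by
  refine ⟨p.totalDegree + 1, fun m hm => ?_⟩
  apply coeff_eq_zero_of_totalDegree_lt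
  simp [Finsupp.degree] at hm
  omega

theorem E_mul {p q : MvPolynomial σ A} {a b : ℕ} (hp : p ∈ E σ A a) (hq : q ∈ E σ A (b + 1)) :
    p * q ∈ E σ A (a + b) := by
  classical
  intro m hm
  rw [coeff_mul]
  refine Finset.sum_eq_zero fun x hx => ?_
  rw [Finset.HasAntidiagonal.mem_antidiagonal] at hx
  by_cases h : a ≤ x.1.degree
  · rw [hp _ h, zero_mul]
  · rw [hq _ ?_, mul_zero]
    rw [← hx, map_add] at hm
    omega

theorem E_mul' {p q : MvPolynomial σ A} {a b : ℕ} (hp : p ∈ E σ A (a + 1))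
    (hq : q ∈ E σ A b) : p * q ∈ E σ A (a + b) := by
  rw [mul_comm, add_comm]; exact E_mul hq hp

theorem comp_E {p : MvPolynomial σ A} {a : ℕ} (hp : p ∈ E σ A a) :
    homogeneousComponent a p = 0 := by
  ext m
  rw [coeff_homogeneousComponent, coeff_zero]
  split_ifs with h
  · exact hp m h.ge
  · rfl

theorem E_drop {p : MvPolynomial σ A} {a : ℕ} (hp : p ∈ E σ A (a + 1))
    (h : homogeneousComponent a p = 0) : p ∈ E σ A a := by
  intro m hm
  rcases hm.eq_or_lt with h1 | h1
  · have := congrArg (coeff m) h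
    rw [coeff_homogeneousComponent, if_pos h1.symm, coeff_zero] at this
    exact this
  · exact hp m h1

theorem E_sub_comp {p : MvPolynomial σ A} {a : ℕ} (hp : p ∈ E σ A (a + 1)) :
    p - homogeneousComponent a p ∈ E σ A a := by
  apply E_drop
  · exact sub_mem hp (E_of_hom (homogeneousComponent_isHomogeneous a p))
  · rw [map_sub, homogeneousComponent_eq_self (homogeneousComponent_isHomogeneous a p), sub_self]

theorem comp_mul {p q : MvPolynomial σ A} {a b : ℕ} (hp : p ∈ E σ A (a + 1))
    (hq : q ∈ E σ A (b + 1)) : homogeneousComponent (a + b) (p * q) =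
      homogeneousComponent a p * homogeneousComponent b q := by
  have h1 : p * q = (p - homogeneousComponent a p) * q +
      homogeneousComponent a p * (q - homogeneousComponent b q) +
      homogeneousComponent a p * homogeneousComponent b q := by ring
  rw [h1, map_add, map_add, comp_E (E_mul (E_sub_comp hp) hq), comp_E (E_mul'
    (E_of_hom (homogeneousComponent_isHomogeneous a p)) (E_sub_comp hq)),
    homogeneousComponent_eq_self ((homogeneousComponent_isHomogeneous a p).mul
      (homogeneousComponent_isHomogeneous b q)), zero_add, zero_add]

theorem comp_mul_hom (p : MvPolynomial σ A) {q : MvPolynomial σ A} (a : ℕ) {b : ℕ}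
    (hq : q.IsHomogeneous b) : homogeneousComponent (a + b) (p * q) =
      homogeneousComponent a p * q := by
  classical
  conv_lhs => rw [← sum_homogeneousComponent p, Finset.sum_mul, map_sum]
  rw [Finset.sum_congr rfl (g := fun i => if i = a then homogeneousComponent a p * q else 0)]
  · rw [Finset.sum_ite_eq']
    split_ifs with h
    · rfl
    · rw [homogeneousComponent_eq_zero, zero_mul]
      simpa using h
  · intro i _
    rw [homogeneousComponent_of_mem ((homogeneousComponent_isHomogeneous i p).mul hq)]
    by_cases h : i = a
    · simp [h]
    · simp [h, Ne.symm h]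

theorem comp_mul_lt (p : MvPolynomial σ A) {q : MvPolynomial σ A} {a b : ℕ}
    (hq : q.IsHomogeneous b) (h : a < b) : homogeneousComponent a (p * q) = 0 := by
  classical
  conv_lhs => rw [← sum_homogeneousComponent p, Finset.sum_mul, map_sum]
  refine Finset.sum_eq_zero fun i _ => ?_
  rw [homogeneousComponent_of_mem ((homogeneousComponent_isHomogeneous i p).mul hq), if_neg]
  omega

end P1a
end C3


namespace C3
section P1b
variable {A : Type} [CommRing A] [IsDomain A] [UniqueFactorizationMonoid A]

/-- homogeneous syzygies -/
theorem syz_hom {G₁ G₂ : MvPolynomial (Fin 2) A} (h1 : G₁.IsHomogeneous 3)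
    (h2 : G₂.IsHomogeneous 3) (h0 : G₁ ≠ 0) (hc : IsRelPrime G₁ G₂) {n : ℕ}
    {u v : MvPolynomial (Fin 2) A} (hu : u.IsHomogeneous n) (hv : v.IsHomogeneous n)
    (h : u * G₁ + v * G₂ = 0) :
    (n < 3 ∧ u = 0 ∧ v = 0) ∨ ∃ j w, n = j + 3 ∧ IsHomogeneous w j ∧ u = -(w * G₂) ∧
      v = w * G₁ := by
  have hd : G₁ ∣ v := by
    refine hc.dvd_of_dvd_mul_right ?_
    exact ⟨-u, by linear_combination h⟩
  obtain ⟨w, hw⟩ := hd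
  have key : ∀ w', v = w' * G₁ → u = -(w' * G₂) := by
    intro w' hw'
    apply mul_right_cancel₀ h0
    rw [hw'] at h
    linear_combination h
  rcases lt_or_ge n 3 with hn | hn
  · left
    have : v = 0 := by
      have := comp_mul_lt w h1 hn
      rw [mul_comm, ← hw, homogeneousComponent_eq_self hv] at this
      exact this
    refine ⟨hn, ?_, this⟩
    have := key 0 (by rw [this, zero_mul])
    simpa using this
  · right
    obtain ⟨j, rfl⟩ := Nat.exists_eq_add_of_le' hn
    have h3 : v = homogeneousComponent j w * G₁ := by
      rw [← comp_mul_hom w j h1, mul_comm w, ← hw, homogeneousComponent_eq_self hv]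
    exact ⟨j, _, rfl, homogeneousComponent_isHomogeneous j w, key _ h3, h3⟩

theorem mem_hom {G₁ G₂ : MvPolynomial (Fin 2) A} (h1 : G₁.IsHomogeneous 3)
    (h2 : G₂.IsHomogeneous 3) {n : ℕ} {r : MvPolynomial (Fin 2) A} (hr : r.IsHomogeneous n)
    (h : r ∈ Ideal.span {G₁, G₂}) :
    (n < 3 ∧ r = 0) ∨ ∃ j u v, n = j + 3 ∧ IsHomogeneous u j ∧ IsHomogeneous v j ∧
      r = u * G₁ + v * G₂ := by
  obtain ⟨a, b, hab⟩ := Ideal.mem_span_pair.mp h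
  rcases lt_or_ge n 3 with hn | hn
  · left
    refine ⟨hn, ?_⟩
    rw [← homogeneousComponent_eq_self hr, ← hab, map_add, comp_mul_lt a h1 hn,
      comp_mul_lt b h2 hn, add_zero]
  · right
    obtain ⟨j, rfl⟩ := Nat.exists_eq_add_of_le' hn
    refine ⟨j, _, _, rfl, homogeneousComponent_isHomogeneous j a,
      homogeneousComponent_isHomogeneous j b, ?_⟩
    rw [← comp_mul_hom a j h1, ← comp_mul_hom b j h2, ← map_add, hab,
      homogeneousComponent_eq_self hr]

theorem X_dvd_of {u v : MvPolynomial (Fin 2) A} (h : X 1 * u = X 0 * v) : (X 0 : MvPolynomial (Fin 2) A) ∣ u := by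
  have hp : Prime (X 0 : MvPolynomial (Fin 2) A) := MvPolynomial.X_prime
  rcases hp.dvd_or_dvd ⟨v, h⟩ with h1 | h1
  · exfalso
    rw [← Ideal.mem_span_singleton, ← Set.image_singleton, mem_ideal_span_X_image] at h1
    obtain ⟨i, hi, hi'⟩ := h1 (Finsupp.single 1 1) (by simp [support_X])
    rw [Set.mem_singleton_iff] at hi
    subst hi
    simp at hi'
  · exact h1

theorem step_mem {G₁ G₂ : MvPolynomial (Fin 2) A} (h1 : G₁.IsHomogeneous 3)
    (h2 : G₂.IsHomogeneous 3) (h0 : G₁ ≠ 0) (hc : IsRelPrime G₁ G₂) {n : ℕ} (hn : n ≤ 3)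
    {r : MvPolynomial (Fin 2) A} (hr : r.IsHomogeneous n)
    (hx : X 0 * r ∈ Ideal.span {G₁, G₂}) (hy : X 1 * r ∈ Ideal.span {G₁, G₂}) :
    r ∈ Ideal.span {G₁, G₂} := by
  rcases mem_hom h1 h2 ((isHomogeneous_X A 0).mul hr) hx with ⟨_, h3⟩ | ⟨j, u, v, hj, hu, hv, h3⟩
  · have : r = 0 := by simpa [X_ne_zero] using h3
    rw [this]; exact zero_mem _
  rcases mem_hom h1 h2 ((isHomogeneous_X A 1).mul hr) hy with ⟨_, h4⟩ | ⟨j', u', v', hj', hu', hv', h4⟩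
  · have : r = 0 := by simpa [X_ne_zero] using h4
    rw [this]; exact zero_mem _
  obtain rfl : j' = j := by omega
  have hs := syz_hom h1 h2 h0 hc (u := X 1 * u - X 0 * u') (v := X 1 * v - X 0 * v')
    (((isHomogeneous_X A 1).mul hu).sub ((isHomogeneous_X A 0).mul hu'))
    (((isHomogeneous_X A 1).mul hv).sub ((isHomogeneous_X A 0).mul hv'))
    (by linear_combination X 0 * h4 - X 1 * h3)
  rcases hs with ⟨_, e1, e2⟩ | ⟨i, w, hi, _⟩
  · obtain ⟨c, rfl⟩ := X_dvd_of (sub_eq_zero.mp e1)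
    obtain ⟨d, rfl⟩ := X_dvd_of (sub_eq_zero.mp e2)
    have : r = c * G₁ + d * G₂ := by
      apply mul_left_cancel₀ (X_ne_zero (R := A) (0 : Fin 2))
      linear_combination h3
    exact Ideal.mem_span_pair.mpr ⟨c, d, this.symm⟩
  · omega

/-- duality for the leading forms -/
theorem duality {G₁ G₂ : MvPolynomial (Fin 2) A} (h1 : G₁.IsHomogeneous 3)
    (h2 : G₂.IsHomogeneous 3) (h0 : G₁ ≠ 0) (hc : IsRelPrime G₁ G₂)
    (τ : MvPolynomial (Fin 2) A →ₗ[A] A)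
    (hτ : ∀ r, IsHomogeneous r 4 → τ r = 0 → r ∈ Ideal.span {G₁, G₂}) (j : ℕ) :
    ∀ n, n + j = 4 → ∀ r, IsHomogeneous r n → (∀ q, IsHomogeneous q j → τ (r * q) = 0) →
    r ∈ Ideal.span {G₁, G₂} := by
  induction j with
  | zero =>
    intro n hn r hr h
    obtain rfl : n = 4 := by omega
    exact hτ r hr (by simpa using h 1 (isHomogeneous_one _ _))
  | succ j ih =>
    intro n hn r hr h
    refine step_mem h1 h2 h0 hc (n := n) (by omega) hr ?_ ?_
    · refine ih (1 + n) (by omega) _ ((isHomogeneous_X A 0).mul hr) fun q hq => ?_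
      rw [mul_comm (X 0) r, mul_assoc]
      exact h _ (by rw [add_comm]; exact (isHomogeneous_X A 0).mul hq)
    · refine ih (1 + n) (by omega) _ ((isHomogeneous_X A 1).mul hr) fun q hq => ?_
      rw [mul_comm (X 1) r, mul_assoc]
      exact h _ (by rw [add_comm]; exact (isHomogeneous_X A 1).mul hq)

/-- the situation of the leading forms -/
structure LF (f₁ f₂ G₁ G₂ : MvPolynomial (Fin 2) A) : Prop where
  e1 : f₁ ∈ E (Fin 2) A 4
  e2 : f₂ ∈ E (Fin 2) A 4
  c1 : homogeneousComponent 3 f₁ = G₁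
  c2 : homogeneousComponent 3 f₂ = G₂
  h0 : G₁ ≠ 0
  hc : IsRelPrime G₁ G₂

theorem LF.h1 {f₁ f₂ G₁ G₂ : MvPolynomial (Fin 2) A} (L : LF f₁ f₂ G₁ G₂) : G₁.IsHomogeneous 3 := by
  rw [← L.c1]; exact homogeneousComponent_isHomogeneous 3 _

theorem LF.h2 {f₁ f₂ G₁ G₂ : MvPolynomial (Fin 2) A} (L : LF f₁ f₂ G₁ G₂) : G₂.IsHomogeneous 3 := by
  rw [← L.c2]; exact homogeneousComponent_isHomogeneous 3 _

theorem LF.top {f₁ f₂ G₁ G₂ : MvPolynomial (Fin 2) A} (L : LF f₁ f₂ G₁ G₂) {n : ℕ}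
    {u v : MvPolynomial (Fin 2) A} (hu : u ∈ E (Fin 2) A (n + 1)) (hv : v ∈ E (Fin 2) A (n + 1)) :
    homogeneousComponent (n + 3) (u * f₁ + v * f₂) =
      homogeneousComponent n u * G₁ + homogeneousComponent n v * G₂ := by
  rw [map_add, comp_mul hu L.e1, comp_mul hv L.e2, L.c1, L.c2]

theorem LF.mem {f₁ f₂ G₁ G₂ : MvPolynomial (Fin 2) A} (L : LF f₁ f₂ G₁ G₂) {n : ℕ}
    {u v : MvPolynomial (Fin 2) A} (hu : u ∈ E (Fin 2) A n) (hv : v ∈ E (Fin 2) A n) :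
    u * f₁ + v * f₂ ∈ E (Fin 2) A (n + 3) := add_mem (E_mul hu L.e1) (E_mul hv L.e2)

theorem LF.low {f₁ f₂ G₁ G₂ : MvPolynomial (Fin 2) A} (L : LF f₁ f₂ G₁ G₂) (m n : ℕ) :
    ∀ u v : MvPolynomial (Fin 2) A, u ∈ E (Fin 2) A (m + n) → v ∈ E (Fin 2) A (m + n) →
      u * f₁ + v * f₂ ∈ E (Fin 2) A (m + 3) →
    ∃ u' v', u' ∈ E (Fin 2) A m ∧ v' ∈ E (Fin 2) A m ∧ u * f₁ + v * f₂ = u' * f₁ + v' * f₂ := by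
  induction n with
  | zero => exact fun u v hu hv _ => ⟨u, v, hu, hv, rfl⟩
  | succ n ih =>
    intro u v hu hv h
    have ht := L.top (n := m + n) hu hv
    rw [comp_E (E_mono (by omega) h)] at ht
    rcases syz_hom L.h1 L.h2 L.h0 L.hc (homogeneousComponent_isHomogeneous _ u)
      (homogeneousComponent_isHomogeneous _ v) ht.symm with ⟨_, a, b⟩ | ⟨j, w, hj, hw, a, b⟩
    · exact ih u v (E_drop hu a) (E_drop hv b) h
    · have hwf1 : w * f₁ ∈ E (Fin 2) A (m + n + 1) := by
        have := E_mul (E_of_hom hw) L.e1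
        exact E_mono (by omega) this
      have hwf2 : w * f₂ ∈ E (Fin 2) A (m + n + 1) := by
        have := E_mul (E_of_hom hw) L.e2
        exact E_mono (by omega) this
      have e : u * f₁ + v * f₂ = (u + w * f₂) * f₁ + (v - w * f₁) * f₂ := by ring
      rw [e] at h ⊢
      refine ih _ _ (E_drop (add_mem hu hwf2) ?_) (E_drop (sub_mem hv hwf1) ?_) h
      · rw [map_add, a, hj, comp_mul (E_of_hom hw) L.e2, L.c2, homogeneousComponent_eq_self hw]
        ring
      · rw [map_sub, b, hj, comp_mul (E_of_hom hw) L.e1, L.c1, homogeneousComponent_eq_self hw]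
        ring

theorem LF.low' {f₁ f₂ G₁ G₂ : MvPolynomial (Fin 2) A} (L : LF f₁ f₂ G₁ G₂) (m : ℕ)
    {p : MvPolynomial (Fin 2) A} (hp : p ∈ Ideal.span {f₁, f₂}) (h : p ∈ E (Fin 2) A (m + 3)) :
    ∃ u v, u ∈ E (Fin 2) A m ∧ v ∈ E (Fin 2) A m ∧ p = u * f₁ + v * f₂ := by
  obtain ⟨u, v, rfl⟩ := Ideal.mem_span_pair.mp hp
  obtain ⟨a, ha⟩ := E_exists u
  obtain ⟨b, hb⟩ := E_exists v
  exact L.low m (a + b) u v (E_mono (by omega) ha) (E_mono (by omega) hb) h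

end P1b
end C3


namespace C3
section P1c

/-- exponent `(i, n - i)` -/
def ex2 (n i : ℕ) : Fin 2 →₀ ℕ := Finsupp.single 0 i + Finsupp.single 1 (n - i)

theorem ex2_degree {n i : ℕ} (h : i ≤ n) : (ex2 n i).degree = n := by
  rw [ex2, map_add, Finsupp.degree_single, Finsupp.degree_single]; omega

theorem ex2_eq {n : ℕ} {m : Fin 2 →₀ ℕ} (h : m.degree = n) : ex2 n (m 0) = m := by
  rw [Finsupp.degree_eq_sum, Fin.sum_univ_two] at h
  ext i
  fin_cases i
  · simp [ex2]
  · simp [ex2]; omega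

theorem ex2_inj {n i j : ℕ} (h : ex2 n i = ex2 n j) : i = j := by
  have := DFunLike.congr_fun h 0
  simpa [ex2] using this

variable {k : Type} [Field k]

theorem finrank_S (n : ℕ) : Module.finrank k (homogeneousSubmodule (Fin 2) k n) = n + 1 := by
  classical
  let T : homogeneousSubmodule (Fin 2) k n →ₗ[k] (Fin (n + 1) → k) :=
    LinearMap.pi (fun i => (lcoeff k (ex2 n i)) ∘ₗ (homogeneousSubmodule (Fin 2) k n).subtype)
  have hT : ∀ p i, T p i = coeff (ex2 n i) p.1 := fun p i => rfl
  have inj : Function.Injective T := by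
    rw [injective_iff_map_eq_zero]
    intro p hp
    apply Subtype.ext
    ext m
    by_cases hm : m.degree = n
    · have h0 : m 0 ≤ n := by
        rw [Finsupp.degree_eq_sum, Fin.sum_univ_two] at hm; omega
      have := congrFun hp ⟨m 0, by omega⟩
      rw [hT, ex2_eq hm] at this
      simpa using this
    · rw [IsHomogeneous.coeff_eq_zero (n := n) p.2 hm]; simp
  have surj : Function.Surjective T := by
    intro c
    refine ⟨⟨∑ i : Fin (n + 1), monomial (ex2 n i) (c i), ?_⟩, ?_⟩
    · refine Submodule.sum_mem _ fun i _ => ?_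
      exact isHomogeneous_monomial _ (ex2_degree (by omega))
    · ext j
      rw [hT]
      simp only [coeff_sum, coeff_monomial]
      rw [Finset.sum_eq_single j]
      · simp
      · intro b _ hb
        rw [if_neg]
        intro h
        exact hb (Fin.ext (ex2_inj h))
      · simp
  rw [(LinearEquiv.ofBijective T ⟨inj, surj⟩).finrank_eq]
  simp

instance (n : ℕ) : Module.Finite k (homogeneousSubmodule (Fin 2) k n) :=
  Module.finite_of_finrank_pos (by rw [finrank_S]; omega)

/-- multiplication map `(u,v) ↦ u g₁ + v g₂` in fixed degree -/
def gmap {g₁ g₂ : MvPolynomial (Fin 2) k} (h1 : g₁.IsHomogeneous 3) (h2 : g₂.IsHomogeneous 3)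
    (n : ℕ) : (homogeneousSubmodule (Fin 2) k n × homogeneousSubmodule (Fin 2) k n) →ₗ[k]
      homogeneousSubmodule (Fin 2) k (n + 3) where
  toFun w := ⟨w.1.1 * g₁ + w.2.1 * g₂, ((show IsHomogeneous _ _ from w.1.2).mul h1).add
    ((show IsHomogeneous _ _ from w.2.2).mul h2)⟩
  map_add' w z := by
    apply Subtype.ext
    simp; ring
  map_smul' c w := by
    apply Subtype.ext
    simp [smul_add]

theorem gmap_inj {g₁ g₂ : MvPolynomial (Fin 2) k} (h1 : g₁.IsHomogeneous 3)
    (h2 : g₂.IsHomogeneous 3) (h0 : g₁ ≠ 0) (hc : IsRelPrime g₁ g₂) {n : ℕ} (hn : n < 3) :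
    Function.Injective (gmap h1 h2 n) := by
  rw [injective_iff_map_eq_zero]
  rintro ⟨u, v⟩ h
  have h' : u.1 * g₁ + v.1 * g₂ = 0 := congrArg Subtype.val h
  rcases syz_hom h1 h2 h0 hc u.2 v.2 h' with ⟨_, a, b⟩ | ⟨j, w, hj, _⟩
  · exact Prod.ext (Subtype.ext a) (Subtype.ext b)
  · omega

theorem gmap_surj {g₁ g₂ : MvPolynomial (Fin 2) k} (h1 : g₁.IsHomogeneous 3)
    (h2 : g₂.IsHomogeneous 3) (h0 : g₁ ≠ 0) (hc : IsRelPrime g₁ g₂) :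
    Function.Surjective (gmap h1 h2 2) := by
  rw [← LinearMap.injective_iff_surjective_of_finrank_eq_finrank]
  · exact gmap_inj h1 h2 h0 hc (by omega)
  · rw [Module.finrank_prod, finrank_S, finrank_S]

theorem exists_tau {g₁ g₂ : MvPolynomial (Fin 2) k} (h1 : g₁.IsHomogeneous 3)
    (h2 : g₂.IsHomogeneous 3) (h0 : g₁ ≠ 0) (hc : IsRelPrime g₁ g₂) :
    ∃ (τ : MvPolynomial (Fin 2) k →ₗ[k] k) (ω : MvPolynomial (Fin 2) k),
      ω.IsHomogeneous 4 ∧ τ ω = 1 ∧ (∀ p, τ p = τ (homogeneousComponent 4 p)) ∧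
      (∀ r, r.IsHomogeneous 4 → τ r = 0 → r ∈ Ideal.span {g₁, g₂}) ∧
      (∀ u, u.IsHomogeneous 1 → τ (u * g₁) = 0 ∧ τ (u * g₂) = 0) := by
  have hr := LinearMap.finrank_range_of_inj (gmap_inj h1 h2 h0 hc (n := 1) (by omega))
  rw [Module.finrank_prod, finrank_S] at hr
  have hq := Submodule.finrank_quotient_add_finrank (LinearMap.range (gmap h1 h2 1))
  rw [hr, finrank_S] at hq
  have hq1 : Module.finrank k (homogeneousSubmodule (Fin 2) k (1 + 3) ⧸
      LinearMap.range (gmap h1 h2 1)) = Module.finrank k k := by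
    rw [Module.finrank_self]; omega
  let e := LinearEquiv.ofFinrankEq _ _ hq1
  let τ₀ : homogeneousSubmodule (Fin 2) k (1 + 3) →ₗ[k] k :=
    e.toLinearMap ∘ₗ (LinearMap.range (gmap h1 h2 1)).mkQ
  have hτ₀ : ∀ r, τ₀ r = 0 ↔ r ∈ LinearMap.range (gmap h1 h2 1) := by
    intro r
    change e (Submodule.Quotient.mk r) = 0 ↔ _
    rw [LinearEquiv.map_eq_zero_iff, Submodule.Quotient.mk_eq_zero]
  let pr : MvPolynomial (Fin 2) k →ₗ[k] homogeneousSubmodule (Fin 2) k (1 + 3) :=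
    LinearMap.codRestrict _ (homogeneousComponent 4)
      (fun p => homogeneousComponent_isHomogeneous 4 p)
  have hpr : ∀ r (h : r.IsHomogeneous 4), pr r = ⟨r, h⟩ := fun r h =>
    Subtype.ext (homogeneousComponent_eq_self h)
  obtain ⟨ω, hω⟩ : ∃ ω, τ₀ ω = 1 := by
    obtain ⟨w, hw⟩ := e.surjective 1
    obtain ⟨w, rfl⟩ := Submodule.Quotient.mk_surjective _ w
    exact ⟨w, hw⟩
  have hω4 : ω.1.IsHomogeneous 4 := ω.2
  refine ⟨τ₀ ∘ₗ pr, ω.1, hω4, ?_, ?_, ?_, ?_⟩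
  · change τ₀ (pr ω.1) = 1
    rw [hpr _ hω4, hω]
  · intro p
    change τ₀ (pr p) = τ₀ (pr _)
    congr 1
    rw [hpr _ (homogeneousComponent_isHomogeneous 4 p)]
    rfl
  · intro r hr h
    change τ₀ (pr r) = 0 at h
    rw [hpr _ hr, hτ₀] at h
    obtain ⟨w, hw⟩ := h
    exact Ideal.mem_span_pair.mpr ⟨_, _, congrArg Subtype.val hw⟩
  · intro u hu
    constructor
    · change τ₀ (pr _) = 0
      rw [hpr _ (hu.mul h1), hτ₀]
      exact ⟨(⟨u, hu⟩, 0), Subtype.ext (by simp [gmap])⟩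
    · change τ₀ (pr _) = 0
      rw [hpr _ (hu.mul h2), hτ₀]
      exact ⟨(0, ⟨u, hu⟩), Subtype.ext (by simp [gmap])⟩

variable {A : Type} [CommRing A] [Algebra k A]

theorem hom_ind (W : Submodule A (MvPolynomial (Fin 2) A)) {n : ℕ}
    (h : ∀ s : MvPolynomial (Fin 2) k, s.IsHomogeneous n → map (algebraMap k A) s ∈ W)
    {r : MvPolynomial (Fin 2) A} (hr : r.IsHomogeneous n) : r ∈ W := by
  rw [← support_sum_monomial_coeff r]
  refine Submodule.sum_mem _ fun m hm => ?_
  have e : monomial m (coeff m r) = coeff m r • map (algebraMap k A) (monomial m (1 : k)) := by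
    rw [map_monomial, map_one, smul_monomial, smul_eq_mul, mul_one]
  rw [e]
  refine W.smul_mem _ (h _ (isHomogeneous_monomial _ ?_))
  by_contra hne
  exact mem_support_iff.mp hm (hr.coeff_eq_zero hne)

/-- extension of a functional by scalars -/
def ext (A : Type) [CommRing A] [Algebra k A] (τ : MvPolynomial (Fin 2) k →ₗ[k] k) :
    MvPolynomial (Fin 2) A →ₗ[A] A :=
  (basisMonomials (Fin 2) A).constr A (fun m => algebraMap k A (τ (monomial m 1)))

theorem ext_monomial (τ : MvPolynomial (Fin 2) k →ₗ[k] k) (m : Fin 2 →₀ ℕ) (a : A) :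
    ext A τ (monomial m a) = a * algebraMap k A (τ (monomial m 1)) := by
  have e : (monomial m a : MvPolynomial (Fin 2) A) = a • basisMonomials (Fin 2) A m := by
    rw [coe_basisMonomials, smul_monomial, smul_eq_mul, mul_one]
  rw [e, map_smul, ext, Module.Basis.constr_basis, smul_eq_mul]

theorem ext_map (τ : MvPolynomial (Fin 2) k →ₗ[k] k) (s : MvPolynomial (Fin 2) k) :
    ext A τ (map (algebraMap k A) s) = algebraMap k A (τ s) := by
  rw [← support_sum_monomial_coeff s, map_sum, map_sum, map_sum, map_sum]
  refine Finset.sum_congr rfl fun m _ => ?_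
  have e : ∀ b : k, (monomial m b : MvPolynomial (Fin 2) k) = b • monomial m 1 := fun b => by
    rw [smul_monomial, smul_eq_mul, mul_one]
  rw [map_monomial, ext_monomial, e (coeff m s), map_smul, smul_eq_mul, map_mul]

theorem ext_sum (τ : MvPolynomial (Fin 2) k →ₗ[k] k) (p : MvPolynomial (Fin 2) A) :
    ext A τ p = ∑ m ∈ p.support, coeff m p * algebraMap k A (τ (monomial m 1)) := by
  conv_lhs => rw [← support_sum_monomial_coeff p, map_sum]
  exact Finset.sum_congr rfl fun m _ => ext_monomial τ m _

theorem ext_comp (τ : MvPolynomial (Fin 2) k →ₗ[k] k)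
    (hτ : ∀ p, τ p = τ (homogeneousComponent 4 p)) (p : MvPolynomial (Fin 2) A) :
    ext A τ p = ext A τ (homogeneousComponent 4 p) := by
  have key : ext A τ = ext A τ ∘ₗ homogeneousComponent 4 := by
    refine (basisMonomials (Fin 2) A).ext fun m => ?_
    rw [coe_basisMonomials, LinearMap.comp_apply]
    by_cases hm : m.degree = 4
    · rw [homogeneousComponent_eq_self (isHomogeneous_monomial _ hm)]
    · rw [homogeneousComponent_of_mem (isHomogeneous_monomial (n := m.degree) _ rfl),
        if_neg (Ne.symm hm), map_zero,
        ext_monomial, hτ, homogeneousComponent_of_mem (isHomogeneous_monomial (n := m.degree) _ rfl),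
        if_neg (Ne.symm hm), map_zero, map_zero, mul_zero]
  exact DFunLike.congr_fun key p

end P1c
end C3


namespace C3
section P1d
variable {k A : Type} [Field k] [CommRing A] [IsDomain A] [UniqueFactorizationMonoid A]
  [Algebra k A]

theorem mem_ge5 {g₁ g₂ : MvPolynomial (Fin 2) k} (h1 : g₁.IsHomogeneous 3)
    (h2 : g₂.IsHomogeneous 3) (h0 : g₁ ≠ 0) (hc : IsRelPrime g₁ g₂) (n : ℕ) :
    ∀ m : Fin 2 →₀ ℕ, m.degree = n + 5 →
      (monomial m (1 : k)) ∈ Ideal.span {g₁, g₂} := by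
  induction n with
  | zero =>
    intro m hm
    obtain ⟨w, hw⟩ := gmap_surj h1 h2 h0 hc ⟨monomial m 1, isHomogeneous_monomial _ (by simpa using hm)⟩
    exact Ideal.mem_span_pair.mpr ⟨_, _, congrArg Subtype.val hw⟩
  | succ n ih =>
    intro m hm
    have : ∃ i, m i ≠ 0 := by
      by_contra hcon
      push Not at hcon
      have : m = 0 := Finsupp.ext hcon
      rw [this] at hm; simp at hm
    obtain ⟨i, hi⟩ := this
    have e : m = (m - Finsupp.single i 1) + Finsupp.single i 1 := by
      rw [tsub_add_cancel_of_le]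
      rw [Finsupp.single_le_iff]; omega
    have hd : (m - Finsupp.single i 1).degree = n + 5 := by
      have := congrArg Finsupp.degree e
      rw [map_add, Finsupp.degree_single] at this
      omega
    rw [e, show (monomial (m - Finsupp.single i 1 + Finsupp.single i 1) (1 : k)) =
      monomial (m - Finsupp.single i 1) 1 * X i by rw [X, monomial_mul, one_mul]]
    exact Ideal.mul_mem_right _ _ (ih _ hd)

theorem map_mem_span {g₁ g₂ p : MvPolynomial (Fin 2) k} (h : p ∈ Ideal.span {g₁, g₂}) :
    map (algebraMap k A) p ∈ Ideal.span {map (algebraMap k A) g₁, map (algebraMap k A) g₂} := by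
  obtain ⟨a, b, rfl⟩ := Ideal.mem_span_pair.mp h
  exact Ideal.mem_span_pair.mpr ⟨map (algebraMap k A) a, map (algebraMap k A) b, by simp⟩

theorem mem_ge5A {g₁ g₂ : MvPolynomial (Fin 2) k} (h1 : g₁.IsHomogeneous 3)
    (h2 : g₂.IsHomogeneous 3) (h0 : g₁ ≠ 0) (hc : IsRelPrime g₁ g₂) {n : ℕ} (hn : 5 ≤ n)
    {r : MvPolynomial (Fin 2) A} (hr : r.IsHomogeneous n) :
    r ∈ Ideal.span {map (algebraMap k A) g₁, map (algebraMap k A) g₂} := by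
  rw [← support_sum_monomial_coeff r]
  refine Submodule.sum_mem _ fun m hm => ?_
  have e : monomial m (coeff m r) = C (coeff m r) * map (algebraMap k A) (monomial m (1 : k)) := by
    rw [map_monomial, map_one, C_mul_monomial, mul_one]
  rw [e]
  refine Ideal.mul_mem_left _ _ (map_mem_span (mem_ge5 h1 h2 h0 hc (n - 5) m ?_))
  by_contra hne
  exact mem_support_iff.mp hm (hr.coeff_eq_zero (by omega))

theorem LF.reduce {f₁ f₂ : MvPolynomial (Fin 2) A} {g₁ g₂ : MvPolynomial (Fin 2) k}
    (h1 : g₁.IsHomogeneous 3) (h2 : g₂.IsHomogeneous 3) (h0 : g₁ ≠ 0) (hc : IsRelPrime g₁ g₂)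
    (L : LF f₁ f₂ (map (algebraMap k A) g₁) (map (algebraMap k A) g₂)) (n : ℕ) :
    ∀ p, p ∈ E (Fin 2) A (5 + n) → ∃ r, r ∈ E (Fin 2) A 5 ∧ p - r ∈ Ideal.span {f₁, f₂} := by
  induction n with
  | zero => exact fun p hp => ⟨p, hp, by rw [sub_self]; exact zero_mem _⟩
  | succ n ih =>
    intro p hp
    rcases mem_hom L.h1 L.h2 (homogeneousComponent_isHomogeneous (5 + n) p)
      (mem_ge5A h1 h2 h0 hc (by omega) (homogeneousComponent_isHomogeneous (5 + n) p)) with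
      ⟨h, _⟩ | ⟨j, u, v, hj, hu, hv, e⟩
    · omega
    · have hE : p - (u * f₁ + v * f₂) ∈ E (Fin 2) A (5 + n) := by
        apply E_drop
        · refine sub_mem hp ?_
          have := L.mem (E_of_hom hu) (E_of_hom hv)
          rwa [show j + 1 + 3 = 5 + n + 1 by omega] at this
        · rw [map_sub, e, hj, L.top (E_of_hom hu) (E_of_hom hv), homogeneousComponent_eq_self hu,
            homogeneousComponent_eq_self hv, sub_self]
      obtain ⟨r, hr, hr'⟩ := ih _ hE
      refine ⟨r, hr, ?_⟩
      have : p - r = (p - (u * f₁ + v * f₂) - r) + (u * f₁ + v * f₂) := by ring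
      rw [this]
      exact add_mem hr' (Ideal.mem_span_pair.mpr ⟨u, v, rfl⟩)

theorem LF.reduce' {f₁ f₂ : MvPolynomial (Fin 2) A} {g₁ g₂ : MvPolynomial (Fin 2) k}
    (h1 : g₁.IsHomogeneous 3) (h2 : g₂.IsHomogeneous 3) (h0 : g₁ ≠ 0) (hc : IsRelPrime g₁ g₂)
    (L : LF f₁ f₂ (map (algebraMap k A) g₁) (map (algebraMap k A) g₂))
    (p : MvPolynomial (Fin 2) A) : ∃ r, r ∈ E (Fin 2) A 5 ∧ p - r ∈ Ideal.span {f₁, f₂} := by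
  obtain ⟨n, hn⟩ := E_exists p
  exact L.reduce h1 h2 h0 hc n p (E_mono (by omega) hn)

theorem LF.exists_sigma {f₁ f₂ : MvPolynomial (Fin 2) A} {g₁ g₂ : MvPolynomial (Fin 2) k}
    (h1 : g₁.IsHomogeneous 3) (h2 : g₂.IsHomogeneous 3) (h0 : g₁ ≠ 0) (hc : IsRelPrime g₁ g₂)
    (L : LF f₁ f₂ (map (algebraMap k A) g₁) (map (algebraMap k A) g₂)) :
    ∃ (τ : MvPolynomial (Fin 2) k →ₗ[k] k) (σ : MvPolynomial (Fin 2) A →ₗ[A] A),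
      (∀ p ∈ Ideal.span {f₁, f₂}, σ p = 0) ∧ (∀ r ∈ E (Fin 2) A 5, σ r = ext A τ r) ∧
      (∀ p, τ p = τ (homogeneousComponent 4 p)) ∧
      (∀ r, (∀ q, σ (r * q) = 0) → r ∈ Ideal.span {f₁, f₂}) := by
  obtain ⟨τ, ω, hω, hτω, hτ4, hτ, hτu⟩ := exists_tau h1 h2 h0 hc
  set ι := map (σ := Fin 2) (algebraMap k A) with hι
  -- vanishing on the leading ideal
  have hu1 : ∀ u : MvPolynomial (Fin 2) A, u.IsHomogeneous 1 → ext A τ (u * ι g₁) = 0 := by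
    intro u hu
    have := hom_ind (k := k) (LinearMap.ker (ext A τ ∘ₗ LinearMap.mulRight A (ι g₁))) (n := 1)
      (fun s hs => ?_) hu
    · exact this
    · rw [LinearMap.mem_ker]
      change ext A τ (ι s * ι g₁) = 0
      rw [← map_mul, ext_map, (hτu s hs).1, map_zero]
  have hu2 : ∀ u : MvPolynomial (Fin 2) A, u.IsHomogeneous 1 → ext A τ (u * ι g₂) = 0 := by
    intro u hu
    have := hom_ind (k := k) (LinearMap.ker (ext A τ ∘ₗ LinearMap.mulRight A (ι g₂))) (n := 1)
      (fun s hs => ?_) hu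
    · exact this
    · rw [LinearMap.mem_ker]
      change ext A τ (ι s * ι g₂) = 0
      rw [← map_mul, ext_map, (hτu s hs).2, map_zero]
  have hker : ∀ r : MvPolynomial (Fin 2) A, r.IsHomogeneous 4 → ext A τ r = 0 →
      r ∈ Ideal.span {ι g₁, ι g₂} := by
    intro r hr h
    let T : MvPolynomial (Fin 2) A →ₗ[A] MvPolynomial (Fin 2) A :=
      LinearMap.id - (LinearMap.toSpanSingleton A _ (ι ω)) ∘ₗ ext A τ
    have hT : ∀ r, T r = r - ext A τ r • ι ω := fun r => rfl
    have := hom_ind (k := k) (((Ideal.span {ι g₁, ι g₂}).restrictScalars A).comap T) (n := 4)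
      (fun s hs => ?_) hr
    · rw [Submodule.mem_comap, hT, h, zero_smul, sub_zero] at this
      exact this
    · rw [Submodule.mem_comap, hT]
      change _ ∈ Ideal.span {ι g₁, ι g₂}
      have e : ι s - ext A τ (ι s) • ι ω = ι (s - τ s • ω) := by
        rw [ext_map, map_sub, smul_eq_C_mul, smul_eq_C_mul, map_mul, map_C]
      rw [e]
      refine map_mem_span (hτ _ (hs.sub ?_) ?_)
      · rw [smul_eq_C_mul]; exact hω.C_mul _
      · rw [map_sub, map_smul, hτω, smul_eq_mul, mul_one, sub_self]
  have hvan : ∀ p ∈ Ideal.span {f₁, f₂}, p ∈ E (Fin 2) A 5 → ext A τ p = 0 := by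
    intro p hp hE
    obtain ⟨u, v, hu, hv, rfl⟩ := L.low' 2 hp hE
    rw [ext_comp τ hτ4, L.top (n := 1) hu hv, map_add,
      hu1 _ (homogeneousComponent_isHomogeneous 1 u),
      hu2 _ (homogeneousComponent_isHomogeneous 1 v), add_zero]
  let π : E (Fin 2) A 5 →ₗ[A] (MvPolynomial (Fin 2) A ⧸ Ideal.span {f₁, f₂}) :=
    (Ideal.Quotient.mkₐ A (Ideal.span {f₁, f₂})).toLinearMap ∘ₗ (E (Fin 2) A 5).subtype
  have hπ : ∀ r, π r = Ideal.Quotient.mk _ r.1 := fun r => rfl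
  have hsurj : Function.Surjective π := by
    intro p
    obtain ⟨p, rfl⟩ := Ideal.Quotient.mk_surjective p
    obtain ⟨r, hr, h⟩ := L.reduce' h1 h2 h0 hc p
    refine ⟨⟨r, hr⟩, ?_⟩
    rw [hπ]
    exact (Ideal.Quotient.eq.mpr h).symm
  let σ₀ : (E (Fin 2) A 5 ⧸ LinearMap.ker π) →ₗ[A] A :=
    (LinearMap.ker π).liftQ (ext A τ ∘ₗ (E (Fin 2) A 5).subtype) (by
      intro r hr
      rw [LinearMap.mem_ker, hπ, Ideal.Quotient.eq_zero_iff_mem] at hr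
      exact hvan _ hr r.2)
  let σ : MvPolynomial (Fin 2) A →ₗ[A] A := σ₀ ∘ₗ
    (π.quotKerEquivOfSurjective hsurj).symm.toLinearMap ∘ₗ
    (Ideal.Quotient.mkₐ A (Ideal.span {f₁, f₂})).toLinearMap
  have hσK : ∀ p ∈ Ideal.span {f₁, f₂}, σ p = 0 := by
    intro p hp
    change σ₀ ((π.quotKerEquivOfSurjective hsurj).symm (Ideal.Quotient.mk _ p)) = 0
    rw [Ideal.Quotient.eq_zero_iff_mem.mpr hp, map_zero, map_zero]
  have hσE : ∀ r ∈ E (Fin 2) A 5, σ r = ext A τ r := by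
    intro r hr
    change σ₀ ((π.quotKerEquivOfSurjective hsurj).symm (Ideal.Quotient.mk _ r)) = _
    have : (π.quotKerEquivOfSurjective hsurj).symm (Ideal.Quotient.mk _ r) =
        Submodule.Quotient.mk ⟨r, hr⟩ := by
      rw [LinearEquiv.symm_apply_eq]
      rfl
    rw [this]
    rfl
  refine ⟨τ, σ, hσK, hσE, hτ4, ?_⟩
  -- nondegeneracy
  have main : ∀ n, n ≤ 5 → ∀ r, r ∈ E (Fin 2) A n → (∀ q, σ (r * q) = 0) →
      r ∈ Ideal.span {f₁, f₂} := by
    intro n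
    induction n with
    | zero =>
      intro _ r hr _
      rw [E_zero hr]; exact zero_mem _
    | succ m ih =>
      intro hm r hr h
      have hmem : homogeneousComponent m r ∈ Ideal.span {ι g₁, ι g₂} := by
        refine duality L.h1 L.h2 L.h0 L.hc (ext A τ) hker (4 - m) m (by omega) _
          (homogeneousComponent_isHomogeneous m r) fun q hq => ?_
        have h5 : r * q ∈ E (Fin 2) A 5 := by
          have := E_mul hr (E_of_hom hq)
          rwa [show m + 1 + (4 - m) = 5 by omega] at this
        have := h q
        rw [hσE _ h5, ext_comp τ hτ4] at this
        have e := comp_mul hr (E_of_hom hq)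
        rw [show m + (4 - m) = 4 by omega, homogeneousComponent_eq_self hq] at e
        rwa [e] at this
      rcases mem_hom L.h1 L.h2 (homogeneousComponent_isHomogeneous m r) hmem with
        ⟨_, h3⟩ | ⟨j, u, v, hj, hu, hv, e⟩
      · exact ih (by omega) r (E_drop hr h3) h
      · have hE : r - (u * f₁ + v * f₂) ∈ E (Fin 2) A m := by
          apply E_drop
          · refine sub_mem hr ?_
            have := L.mem (E_of_hom hu) (E_of_hom hv)
            rwa [show j + 1 + 3 = m + 1 by omega] at this
          · rw [map_sub, e, hj, L.top (E_of_hom hu) (E_of_hom hv),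
              homogeneousComponent_eq_self hu, homogeneousComponent_eq_self hv, sub_self]
        have hK : u * f₁ + v * f₂ ∈ Ideal.span {f₁, f₂} := Ideal.mem_span_pair.mpr ⟨u, v, rfl⟩
        have := ih (by omega) _ hE (fun q => by
          rw [sub_mul, map_sub, h q, hσK _ (Ideal.mul_mem_right _ _ hK), sub_zero])
        have := add_mem this hK
        rwa [sub_add_cancel] at this
  intro r h
  obtain ⟨r', hr', hd⟩ := L.reduce' h1 h2 h0 hc r
  have := main 5 le_rfl r' hr' (fun q => by
    have e : r' * q = r * q - (r - r') * q := by ring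
    rw [e, map_sub, h q, hσK _ (Ideal.mul_mem_right _ _ hd), sub_zero])
  have := add_mem hd this
  rwa [sub_add_cancel] at this

end P1d
end C3


namespace C3
section P2
variable {k A : Type} [Field k] [CommRing A] [IsDomain A] [UniqueFactorizationMonoid A]
  [Algebra k A]

theorem exists_factor {A P M N : Type} [CommRing A] [AddCommGroup P] [Module A P] [AddCommGroup M]
    [Module A M] [AddCommGroup N] [Module A N]
    (π : P →ₗ[A] M) (hπ : Function.Surjective π) (ψ : P →ₗ[A] N) (h : ∀ p, π p = 0 → ψ p = 0) :
    ∃ φ : M →ₗ[A] N, ∀ p, φ (π p) = ψ p := by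
  refine ⟨(LinearMap.ker π).liftQ ψ (fun p hp => h p hp) ∘ₗ
    (π.quotKerEquivOfSurjective hπ).symm.toLinearMap, fun p => ?_⟩
  have : (π.quotKerEquivOfSurjective hπ).symm (π p) = Submodule.Quotient.mk p := by
    rw [LinearEquiv.symm_apply_eq]; rfl
  rw [LinearMap.comp_apply, LinearEquiv.coe_coe, this]
  rfl

theorem coeff_four (V : Submodule k A) {s : MvPolynomial (Fin 2) k} (hs : s.IsHomogeneous 2)
    {f : MvPolynomial (Fin 2) A} (hf : ∀ m : Fin 2 →₀ ℕ, m.degree = 2 → coeff m f ∈ V)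
    {m : Fin 2 →₀ ℕ} (hm : m.degree = 4) : coeff m (map (algebraMap k A) s * f) ∈ V := by
  classical
  rw [coeff_mul]
  refine Submodule.sum_mem _ fun x hx => ?_
  rw [Finset.HasAntidiagonal.mem_antidiagonal] at hx
  rw [coeff_map, ← Algebra.smul_def]
  by_cases h : x.1.degree = 2
  · refine V.smul_mem _ (hf _ ?_)
    have := congrArg Finsupp.degree hx
    rw [map_add] at this
    omega
  · rw [hs.coeff_eq_zero h, zero_smul]
    exact V.zero_mem

theorem E_eq_restrict (n : ℕ) : E (Fin 2) A (n + 1) = restrictTotalDegree (Fin 2) A n := by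
  ext p
  rw [mem_restrictTotalDegree, mem_E, totalDegree, Finset.sup_le_iff]
  constructor
  · intro h m hm
    by_contra hcon
    refine mem_support_iff.mp hm (h m ?_)
    rw [Finsupp.degree_eq_sum, ← Finsupp.sum_fintype m (fun _ e => e) (fun _ => rfl)]
    omega
  · intro h m hm
    by_contra hcon
    have := h m (mem_support_iff.mpr hcon)
    rw [Finsupp.degree_eq_sum, ← Finsupp.sum_fintype m (fun _ e => e) (fun _ => rfl)] at hm
    omega

theorem free_of_data {f₁ f₂ f₃ : MvPolynomial (Fin 2) A} {g₁ g₂ g₃ : MvPolynomial (Fin 2) k}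
    (h1 : g₁.IsHomogeneous 3) (h2 : g₂.IsHomogeneous 3) (h3 : g₃.IsHomogeneous 3)
    (h0 : g₁ ≠ 0) (hc : IsRelPrime g₁ g₂)
    (L : LF f₁ f₂ (map (algebraMap k A) g₁) (map (algebraMap k A) g₂))
    (e3 : f₃ ∈ E (Fin 2) A 4) (c3 : homogeneousComponent 3 f₃ = map (algebraMap k A) g₃)
    (V : Submodule k A) (hV : ∀ v ∈ V, v = 0 ∨ Prime v)
    (hv1 : ∀ m : Fin 2 →₀ ℕ, m.degree = 2 → coeff m f₁ ∈ V)
    (hv2 : ∀ m : Fin 2 →₀ ℕ, m.degree = 2 → coeff m f₂ ∈ V)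
    (hv3 : ∀ m : Fin 2 →₀ ℕ, m.degree = 2 → coeff m f₃ ∈ V)
    (J : Ideal (MvPolynomial (Fin 2) A))
    (hJ : ∀ r, r ∈ J ↔ f₃ * r ∈ Ideal.span {f₁, f₂})
    (hrk : ∀ v : Fin 4 → MvPolynomial (Fin 2) A, ∃ a : Fin 4 → A, a ≠ 0 ∧ ∑ i, a i • v i ∈ J) :
    Module.Free A (MvPolynomial (Fin 2) A ⧸ J) := by
  obtain ⟨τ, σ, hσK, hσE, hτ4, hnd⟩ := L.exists_sigma h1 h2 h0 hc
  let π : MvPolynomial (Fin 2) A →ₐ[A] (MvPolynomial (Fin 2) A ⧸ J) := Ideal.Quotient.mkₐ A J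
  have hπ : Function.Surjective π := Ideal.Quotient.mk_surjective
  have hπ0 : ∀ p, π p = 0 ↔ p ∈ J := fun p => Ideal.Quotient.eq_zero_iff_mem
  obtain ⟨φ, hφ⟩ := exists_factor π.toLinearMap hπ (σ ∘ₗ LinearMap.mulLeft A f₃) (fun p hp =>
    hσK _ ((hJ p).mp ((hπ0 p).mp hp)))
  replace hφ : ∀ p, φ (π p) = σ (f₃ * p) := hφ
  haveI : Module.Finite A (MvPolynomial (Fin 2) A ⧸ J) := by
    have hfin : Module.Finite A (E (Fin 2) A 5) := by rw [E_eq_restrict]; infer_instance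
    refine Module.Finite.of_surjective (π.toLinearMap ∘ₗ (E (Fin 2) A 5).subtype) fun m => ?_
    obtain ⟨p, rfl⟩ := hπ m
    obtain ⟨r, hr, h⟩ := L.reduce' h1 h2 h0 hc p
    refine ⟨⟨r, hr⟩, ?_⟩
    change π r = π p
    symm
    rw [← sub_eq_zero, ← map_sub, hπ0, hJ]
    exact Ideal.mul_mem_left _ _ h
  -- values of the functional in degree two
  have hdeg2 : ∀ s : MvPolynomial (Fin 2) k, s.IsHomogeneous 2 →
      σ (f₃ * map (algebraMap k A) s) ∈ V := by
    intro s hs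
    obtain ⟨⟨u, v⟩, huv⟩ := gmap_surj h1 h2 h0 hc ⟨g₃ * s, h3.mul hs⟩
    replace huv : u.1 * g₁ + v.1 * g₂ = g₃ * s := congrArg Subtype.val huv
    have hu : u.1.IsHomogeneous 2 := u.2
    have hv : v.1.IsHomogeneous 2 := v.2
    set ι := map (σ := Fin 2) (algebraMap k A) with hι
    have hK : ι u.1 * f₁ + ι v.1 * f₂ ∈ Ideal.span {f₁, f₂} :=
      Ideal.mem_span_pair.mpr ⟨_, _, rfl⟩
    have hE : f₃ * ι s - (ι u.1 * f₁ + ι v.1 * f₂) ∈ E (Fin 2) A 5 := by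
      apply E_drop
      · exact sub_mem (E_mul (a := 4) (b := 2) e3 (E_of_hom (hs.map _))) (L.mem (E_of_hom (hu.map _))
          (E_of_hom (hv.map _)))
      · rw [map_sub, L.top (n := 2) (E_of_hom (hu.map _)) (E_of_hom (hv.map _)),
          comp_mul (a := 3) (b := 2) e3 (E_of_hom (hs.map _)), c3,
          homogeneousComponent_eq_self (hs.map _), homogeneousComponent_eq_self (hu.map _),
          homogeneousComponent_eq_self (hv.map _), ← map_mul, ← huv, map_add, map_mul, map_mul]
        exact sub_self _
    have e : σ (f₃ * ι s) = ext A τ (f₃ * ι s - (ι u.1 * f₁ + ι v.1 * f₂)) := by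
      rw [← hσE _ hE, map_sub, hσK _ hK, sub_zero]
    rw [e, ext_sum]
    refine Submodule.sum_mem _ fun m _ => ?_
    rw [mul_comm, ← Algebra.smul_def]
    by_cases hm : m.degree = 4
    · refine V.smul_mem _ ?_
      rw [coeff_sub, coeff_add, mul_comm f₃]
      exact sub_mem (coeff_four V hs hv3 hm)
        (add_mem (coeff_four V hu hv1 hm) (coeff_four V hv hv2 hm))
    · rw [hτ4, homogeneousComponent_of_mem (isHomogeneous_monomial (n := m.degree) _ rfl),
        if_neg (Ne.symm hm), map_zero, zero_smul]
      exact V.zero_mem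
  have hdeg1 : ∀ i, φ (π (X i)) = algebraMap k A (τ (g₃ * X i)) := by
    intro i
    rw [hφ, hσE _ (E_mul e3 (E_of_hom (isHomogeneous_X A i))), ext_comp τ hτ4,
      comp_mul (a := 3) (b := 1) e3 (E_of_hom (isHomogeneous_X A i)), c3,
      homogeneousComponent_eq_self (isHomogeneous_X A i), ← ext_map, (MvPolynomial.map (algebraMap k A)).map_mul, map_X]
  refine free_main φ ?_ ?_ V hV (π (X 0)) (π (X 1)) ?_ ?_ _ _ (hdeg1 0) (hdeg1 1) ?_ ?_ ?_
  · intro m hm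
    obtain ⟨p, rfl⟩ := hπ m
    rw [hπ0, hJ]
    apply hnd
    intro q
    rw [mul_assoc, ← hφ, map_mul]
    exact hm _
  · intro v
    choose w hw using fun i => hπ (v i)
    obtain ⟨a, ha, h⟩ := hrk w
    refine ⟨a, ha, ?_⟩
    rw [← hπ0, map_sum] at h
    rw [← h]
    refine Finset.sum_congr rfl fun i _ => ?_
    rw [map_smul, hw]
  · have h := congrArg (Subalgebra.map π) (adjoin_range_X (R := A) (σ := Fin 2))
    rw [AlgHom.map_adjoin, Algebra.map_top, (AlgHom.range_eq_top π).mpr hπ] at h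
    rw [← h]
    congr 1
    ext z
    simp [eq_comm]
  · have e : (1 : MvPolynomial (Fin 2) A ⧸ J) = π 1 := (map_one π).symm
    rw [e, hφ, mul_one, hσE _ (E_mono (by omega) e3), ext_comp τ hτ4, comp_E e3, map_zero]
  · rw [← map_mul, hφ]
    simpa using hdeg2 (X 0 * X 0) ((isHomogeneous_X k 0).mul (isHomogeneous_X k 0))
  · rw [← map_mul, hφ]
    simpa using hdeg2 (X 0 * X 1) ((isHomogeneous_X k 0).mul (isHomogeneous_X k 1))
  · rw [← map_mul, hφ]
    simpa using hdeg2 (X 1 * X 1) ((isHomogeneous_X k 1).mul (isHomogeneous_X k 1))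

end P2
end C3


namespace C3
section P3a
variable {k : Type} [Field k]

/-- exponents of degree less than `n` -/
def Fset (d n : ℕ) : Finset (Fin d →₀ ℕ) :=
  (Finset.range n).biUnion (fun i => Finset.finsuppAntidiag Finset.univ i)

theorem mem_Fset {d n : ℕ} {m : Fin d →₀ ℕ} : m ∈ Fset d n ↔ m.degree < n := by
  simp only [Fset, Finset.mem_biUnion, Finset.mem_range, Finset.mem_finsuppAntidiag]
  rw [Finsupp.degree_eq_sum]
  constructor
  · rintro ⟨i, hi, h, _⟩
    have h' : ∑ i, m i = i := h
    omega
  · intro h; exact ⟨_, h, rfl, Finset.subset_univ _⟩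

theorem card_Fset (d n : ℕ) : (Fset d (n + 1)).card = (d + n).choose d := by
  rw [Fset, Finset.card_biUnion]
  · rw [add_comm d n, ← Nat.sum_range_multichoose]
    refine Finset.sum_congr rfl fun i _ => ?_
    rw [Finset.card_finsuppAntidiag_nat_eq_multichoose]
    simp
  · intro i _ j _ hij
    rw [Function.onFun, Finset.disjoint_left]
    intro m hm hm'
    rw [Finset.mem_finsuppAntidiag] at hm hm'
    exact hij (hm.1.symm.trans hm'.1)

section
end

/-- coordinates on `E` -/
def ecoord (d n : ℕ) : E (Fin d) k n →ₗ[k] (Fset d n → k) :=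
  LinearMap.pi (fun i => (lcoeff k i.1) ∘ₗ (E (Fin d) k n).subtype)

theorem ecoord_bij (d n : ℕ) : Function.Bijective (ecoord (k := k) d n) := by
  classical
  have hT : ∀ p i, ecoord (k := k) d n p i = coeff i.1 p.1 := fun p i => rfl
  constructor
  · rw [injective_iff_map_eq_zero]
    intro p hp
    apply Subtype.ext
    ext m
    by_cases hm : m.degree < n
    · have := congrFun hp ⟨m, mem_Fset.mpr hm⟩
      rw [hT] at this
      simpa using this
    · rw [p.2 m (by omega)]; simp
  · intro c
    refine ⟨⟨∑ i : Fset d n, monomial i.1 (c i), ?_⟩, ?_⟩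
    · refine Submodule.sum_mem _ fun i _ => ?_
      intro m hm
      rw [coeff_monomial, if_neg]
      rintro rfl
      have := mem_Fset.mp i.2
      omega
    · ext j
      rw [hT]
      simp only [coeff_sum, coeff_monomial]
      rw [Finset.sum_eq_single j]
      · simp
      · intro b _ hb
        rw [if_neg]
        intro h
        exact hb (Subtype.ext h)
      · simp

instance instFinE (d n : ℕ) : Module.Finite k (E (Fin d) k n) :=
  Module.Finite.equiv (LinearEquiv.ofBijective _ (ecoord_bij (k := k) d n)).symm

theorem finrank_E (d n : ℕ) : Module.finrank k (E (Fin d) k (n + 1)) = (d + n).choose d := by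
  rw [(LinearEquiv.ofBijective _ (ecoord_bij (k := k) d (n + 1))).finrank_eq, ← card_Fset]
  simp

theorem count {d : ℕ} {P : Type} [CommRing P] [Algebra (MvPolynomial (Fin d) k) P] [Algebra k P]
    [IsScalarTower k (MvPolynomial (Fin d) k) P] (I M : Ideal P) (n D : ℕ)
    (hM : ∀ a : MvPolynomial (Fin d) k, (∀ m, m.degree < n + D → coeff m a = 0) →
      algebraMap _ P a ∈ M) {s t : Type} [Fintype s] [Fintype t] (b : s → P)
    (hb : ∀ p, ∃ c : s → MvPolynomial (Fin d) k, p - ∑ i, c i • b i ∈ I)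
    (w : t → s → MvPolynomial (Fin d) k)
    (hw : ∀ c : t → MvPolynomial (Fin d) k, ∑ j, c j • w j = 0 → c = 0)
    (hwI : ∀ j, ∑ i, w j i • b i ∈ I) (hD : ∀ j i, w j i ∈ E (Fin d) k (D + 1)) :
    Module.finrank k (P ⧸ (I ⊔ M)) + Fintype.card t * Module.finrank k (E (Fin d) k n) ≤
      Fintype.card s * Module.finrank k (E (Fin d) k (n + D)) := by
  classical
  let A := MvPolynomial (Fin d) k
  let Ψ₀ : (s → E (Fin d) k (n + D)) →ₗ[k] P :=
    { toFun := fun c => ∑ i, (c i : A) • b i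
      map_add' := fun c c' => by
        simp [add_smul, Finset.sum_add_distrib]
      map_smul' := fun r c => by
        simp [Finset.smul_sum] }
  let Ψ : (s → E (Fin d) k (n + D)) →ₗ[k] (P ⧸ (I ⊔ M)) :=
    (Ideal.Quotient.mkₐ k (I ⊔ M)).toLinearMap ∘ₗ Ψ₀
  have hΨ : ∀ c, Ψ c = Ideal.Quotient.mk _ (∑ i, (c i : A) • b i) := fun c => rfl
  let Θ : (t → E (Fin d) k n) →ₗ[k] (s → E (Fin d) k (n + D)) :=
    { toFun := fun c i => ⟨∑ j, (c j : A) * w j i,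
        Submodule.sum_mem _ fun j _ => E_mul (c j).2 (hD j i)⟩
      map_add' := fun c c' => by
        ext1 i
        apply Subtype.ext
        simp [add_mul, Finset.sum_add_distrib]
      map_smul' := fun r c => by
        ext1 i
        apply Subtype.ext
        simp [Finset.smul_sum] }
  have hΘ : ∀ c i, (Θ c i : A) = ∑ j, (c j : A) * w j i := fun c i => rfl
  have surj : Function.Surjective Ψ := by
    intro p
    obtain ⟨p, rfl⟩ := Ideal.Quotient.mk_surjective p
    obtain ⟨c, hc⟩ := hb p
    -- truncations
    have htr : ∀ a : A, ∃ a' : E (Fin d) k (n + D), algebraMap A P (a - a') ∈ M := by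
      intro a
      refine ⟨⟨∑ m ∈ a.support with m.degree < n + D, monomial m (coeff m a),
        Submodule.sum_mem _ fun m hm => ?_⟩, hM _ fun m hm => ?_⟩
      · intro m' hm'
        rw [coeff_monomial, if_neg]
        rintro rfl
        rw [Finset.mem_filter] at hm
        omega
      · rw [coeff_sub]
        simp only [coeff_sum, coeff_monomial]
        rw [Finset.sum_ite_eq']
        split_ifs with h
        · simp
        · rw [Finset.mem_filter, not_and_or] at h
          rcases h with h | h
          · rw [notMem_support_iff.mp h]; simp
          · exact absurd hm h
    choose tr htr using htr
    refine ⟨fun i => tr (c i), ?_⟩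
    rw [hΨ, eq_comm, Ideal.Quotient.eq]
    have e : p - ∑ i, (tr (c i) : A) • b i = (p - ∑ i, c i • b i) +
        ∑ i, (c i - tr (c i)) • b i := by
      simp only [sub_smul, Finset.sum_sub_distrib]; ring
    rw [e]
    refine add_mem (Ideal.mem_sup_left hc) (Ideal.mem_sup_right ?_)
    refine Submodule.sum_mem _ fun i _ => ?_
    rw [Algebra.smul_def]
    exact Ideal.mul_mem_right _ _ (htr _)
  have inj : Function.Injective Θ := by
    rw [injective_iff_map_eq_zero]
    intro c hc
    have := hw (fun j => (c j : A)) (by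
      ext1 i
      have := congrArg Subtype.val (congrFun hc i)
      rw [hΘ] at this
      simpa using this)
    ext1 j
    exact Subtype.ext (congrFun this j)
  have hle : LinearMap.range Θ ≤ LinearMap.ker Ψ := by
    rintro _ ⟨c, rfl⟩
    rw [LinearMap.mem_ker, hΨ, Ideal.Quotient.eq_zero_iff_mem]
    apply Ideal.mem_sup_left
    have e : ∑ i, (Θ c i : A) • b i = ∑ j, (c j : A) • ∑ i, w j i • b i := by
      simp only [hΘ, Finset.sum_smul, Finset.smul_sum, mul_smul]
      rw [Finset.sum_comm]
    rw [e]
    refine Submodule.sum_mem _ fun j _ => ?_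
    rw [Algebra.smul_def]
    exact Ideal.mul_mem_left _ _ (hwI j)
  have h1 := LinearMap.finrank_range_add_finrank_ker Ψ
  rw [LinearMap.range_eq_top.mpr surj, finrank_top, Module.finrank_pi_fintype,
    Finset.sum_const, Finset.card_univ, smul_eq_mul] at h1
  have h2 := Submodule.finrank_mono hle
  rw [LinearMap.finrank_range_of_inj inj, Module.finrank_pi_fintype,
    Finset.sum_const, Finset.card_univ, smul_eq_mul] at h2
  omega

theorem tendsto_choose (d a b : ℕ) : Tendsto (fun n : ℕ => (d.factorial : ℝ) *
    ((n + a).choose d : ℝ) / ((n + b : ℕ) : ℝ) ^ d) atTop (nhds 1) := by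
  have h1 := ((isEquivalent_choose d).comp_tendsto (tendsto_add_atTop_nat a))
  have h2 : Tendsto (fun n : ℕ => (((n + a).choose d : ℕ) : ℝ) /
      (((n + a : ℕ) : ℝ) ^ d / (d.factorial : ℝ))) atTop (nhds 1) := by
    refine (Asymptotics.isEquivalent_iff_tendsto_one ?_).mp h1
    filter_upwards [eventually_ge_atTop 1] with n hn
    have : ((n + a : ℕ) : ℝ) ≠ 0 := by positivity
    positivity
  have h3 : Tendsto (fun n : ℕ => (((n + a : ℕ) : ℝ) / ((n + b : ℕ) : ℝ)) ^ d) atTop (nhds 1) := by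
    have : Tendsto (fun n : ℕ => (((n + a : ℕ) : ℝ) / ((n + b : ℕ) : ℝ))) atTop (nhds 1) := by
      have h4 : Tendsto (fun n : ℕ => (1 : ℝ) + ((a : ℝ) - b) / ((n + b : ℕ) : ℝ)) atTop (nhds (1 + 0)) := by
        refine tendsto_const_nhds.add ?_
        refine Tendsto.div_atTop tendsto_const_nhds ?_
        exact tendsto_natCast_atTop_atTop.comp (tendsto_add_atTop_nat b)
      rw [add_zero] at h4
      refine h4.congr' ?_
      filter_upwards [eventually_ge_atTop 1] with n hn
      have : ((n + b : ℕ) : ℝ) ≠ 0 := by positivity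
      field_simp
      push_cast
      ring
    simpa using this.pow d
  have h5 := h2.mul h3
  rw [one_mul] at h5
  refine h5.congr' ?_
  filter_upwards [eventually_ge_atTop 1] with n hn
  have : ((n + b : ℕ) : ℝ) ≠ 0 := by positivity
  have : ((n + a : ℕ) : ℝ) ≠ 0 := by positivity
  rw [div_pow]
  field_simp

theorem no_count (d D : ℕ) (H : ℕ → ℕ)
    (hH : Tendsto (fun n : ℕ => (Nat.factorial d : ℝ) * (H n : ℝ) / (n : ℝ) ^ d)
    atTop (nhds ((6 : ℕ) : ℝ)))
    (h : ∀ n, H (n + 1 + D) + 10 * (d + n).choose d ≤ 15 * (d + (n + D)).choose d) : False := by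
  have h1 := hH.comp (tendsto_add_atTop_nat (1 + D))
  have h2 := (tendsto_choose d d (1 + D)).const_mul 10
  have h3 := (tendsto_choose d (d + D) (1 + D)).const_mul 15
  have := le_of_tendsto_of_tendsto (h1.add h2) h3 (Eventually.of_forall fun n => by
    simp only [Function.comp]
    have := h n
    have h' : ((H (n + 1 + D) : ℕ) : ℝ) + 10 * ((d + n).choose d : ℕ) ≤
        15 * (((d + (n + D)).choose d : ℕ) : ℝ) := by exact_mod_cast this
    rw [show n + 1 + D = n + (1 + D) by ring, show d + n = n + d by ring,
      show d + (n + D) = n + (d + D) by ring] at h'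
    have e1 : ∀ x y z : ℝ, (d.factorial : ℝ) * x / y + 10 * (d.factorial * z / y) =
      (d.factorial / y) * (x + 10 * z) := fun x y z => by ring
    have e2 : ∀ y z : ℝ, 15 * (d.factorial * z / y) =
      (d.factorial / y) * (15 * z) := fun y z => by ring
    rw [e1, e2]
    exact mul_le_mul_of_nonneg_left h' (by positivity))
  norm_num at this

end P3a
end C3


namespace C3
section P3b

theorem E_expand {A : Type} [CommRing A] {d N : ℕ} {p : MvPolynomial (Fin d) A} (hp : p ∈ E (Fin d) A N) :
    p = ∑ t : Fset d N, coeff t.1 p • monomial t.1 (1 : A) := by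
  classical
  ext m
  simp only [coeff_sum, coeff_smul, coeff_monomial, smul_eq_mul, mul_ite, mul_one, mul_zero]
  by_cases hm : m.degree < N
  · rw [Finset.sum_eq_single ⟨m, mem_Fset.mpr hm⟩]
    · simp
    · intro b _ hb
      rw [if_neg]
      intro h
      exact hb (Subtype.ext h)
    · simp
  · rw [hp m (by omega), Finset.sum_eq_zero]
    intro b _
    rw [if_neg]
    rintro rfl
    exact hm (mem_Fset.mp b.2)

theorem E_comb {A : Type} [CommRing A] {d N : ℕ} (c : Fset d N → A) :
    (∑ t, c t • monomial t.1 (1 : A)) ∈ E (Fin d) A N := by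
  classical
  refine Submodule.sum_mem _ fun t _ => Submodule.smul_mem _ _ ?_
  intro m hm
  rw [coeff_monomial, if_neg]
  rintro rfl
  have := mem_Fset.mp t.2
  omega

theorem comb_zero {A : Type} [CommRing A] {d N : ℕ} (c : Fset d N → A)
    (h : (∑ t, c t • monomial t.1 (1 : A)) = 0) : c = 0 := by
  classical
  ext1 t
  have := congrArg (coeff t.1) h
  simp only [coeff_sum, coeff_smul, coeff_monomial, smul_eq_mul, mul_ite, mul_one, mul_zero] at this
  rw [Finset.sum_eq_single t] at this
  · simpa using this
  · intro b _ hb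
    rw [if_neg]
    intro h
    exact hb (Subtype.ext h)
  · simp

theorem LF.low_zero {A : Type} [CommRing A] [IsDomain A] [UniqueFactorizationMonoid A]
    {f₁ f₂ G₁ G₂ : MvPolynomial (Fin 2) A} (L : LF f₁ f₂ G₁ G₂) (n : ℕ) (hn : n ≤ 3) :
    ∀ u v : MvPolynomial (Fin 2) A, u ∈ E (Fin 2) A n → v ∈ E (Fin 2) A n →
      u * f₁ + v * f₂ = 0 → u = 0 ∧ v = 0 := by
  induction n with
  | zero => exact fun u v hu hv _ => ⟨E_zero hu, E_zero hv⟩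
  | succ n ih =>
    intro u v hu hv h
    have ht := L.top hu hv
    rw [h, map_zero] at ht
    rcases syz_hom L.h1 L.h2 L.h0 L.hc (homogeneousComponent_isHomogeneous n u)
      (homogeneousComponent_isHomogeneous n v) ht.symm with ⟨_, h1, h2⟩ | ⟨j, _, hj, _⟩
    · exact ih (by omega) u v (E_drop hu h1) (E_drop hv h2) h
    · omega

theorem mem_pow_of_low {k : Type} [Field k] {d n : ℕ} {a : MvPolynomial (Fin d) k}
    (h : ∀ m, m.degree < n → coeff m a = 0) : a ∈ (idealOfVars (Fin d) k) ^ n := by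
  rw [mem_pow_idealOfVars_iff']
  intro m hm
  exact h m hm

theorem rank_le {k : Type} [Field k] {d : ℕ}
    {f₁ f₂ f₃ : MvPolynomial (Fin 2) (MvPolynomial (Fin d) k)} {g₁ g₂ : MvPolynomial (Fin 2) k}
    (h1 : g₁.IsHomogeneous 3) (h2 : g₂.IsHomogeneous 3) (h0 : g₁ ≠ 0) (hc : IsRelPrime g₁ g₂)
    (L : LF f₁ f₂ (MvPolynomial.map (algebraMap k (MvPolynomial (Fin d) k)) g₁)
      (MvPolynomial.map (algebraMap k (MvPolynomial (Fin d) k)) g₂))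
    (J : Ideal (MvPolynomial (Fin 2) (MvPolynomial (Fin d) k)))
    (hJ : ∀ r, r ∈ J ↔ f₃ * r ∈ Ideal.span {f₁, f₂})
    (M : Ideal (MvPolynomial (Fin 2) (MvPolynomial (Fin d) k)))
    (hM : ∀ j, C (X j) ∈ M) (H : ℕ → ℕ)
    (hH : ∀ n, H n = Module.finrank k (MvPolynomial (Fin 2) (MvPolynomial (Fin d) k) ⧸
      (Ideal.span {f₁, f₂, f₃} ⊔ M ^ n)))
    (hlim : Tendsto (fun n : ℕ => (Nat.factorial d : ℝ) * (H n : ℝ) / (n : ℝ) ^ d)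
      atTop (nhds ((6 : ℕ) : ℝ)))
    (v : Fin 4 → MvPolynomial (Fin 2) (MvPolynomial (Fin d) k)) :
    ∃ a : Fin 4 → MvPolynomial (Fin d) k, a ≠ 0 ∧ ∑ i, a i • v i ∈ J := by
  classical
  by_contra hcon
  push Not at hcon
  have hind : ∀ a : Fin 4 → MvPolynomial (Fin d) k, ∑ i, a i • v i ∈ J → a = 0 := by
    intro a ha
    by_contra h
    exact hcon a h ha
  have hr : ∀ i, ∃ r, r ∈ E (Fin 2) (MvPolynomial (Fin d) k) 5 ∧
      f₃ * v i - r ∈ Ideal.span {f₁, f₂} := fun i => L.reduce' h1 h2 h0 hc _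
  choose r hr5 hrK using hr
  set I : Ideal (MvPolynomial (Fin 2) (MvPolynomial (Fin d) k)) := Ideal.span {f₁, f₂, f₃} with hI
  have hKI : Ideal.span {f₁, f₂} ≤ I := Ideal.span_mono (by
    intro x hx
    simp only [Set.mem_insert_iff, Set.mem_singleton_iff] at hx ⊢
    tauto)
  have hf1 : f₁ ∈ I := Ideal.subset_span (by simp)
  have hf2 : f₂ ∈ I := Ideal.subset_span (by simp)
  have hf3 : f₃ ∈ I := Ideal.subset_span (by simp)
  let s := Fset 2 5
  let t := (Fset 2 2 ⊕ Fset 2 2) ⊕ Fin 4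
  let W : t → MvPolynomial (Fin 2) (MvPolynomial (Fin d) k) :=
    Sum.elim (Sum.elim (fun i => monomial i.1 1 * f₁) (fun i => monomial i.1 1 * f₂)) r
  have hmon : ∀ i : Fset 2 2, monomial i.1 (1 : MvPolynomial (Fin d) k) ∈
      E (Fin 2) (MvPolynomial (Fin d) k) 2 := by
    intro i m hm
    rw [coeff_monomial, if_neg]
    rintro rfl
    have := mem_Fset.mp i.2
    omega
  have hW5 : ∀ j, W j ∈ E (Fin 2) (MvPolynomial (Fin d) k) 5 := by
    rintro ((i | i) | i)
    · exact E_mul (hmon i) L.e1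
    · exact E_mul (hmon i) L.e2
    · exact hr5 i
  have hWI : ∀ j, W j ∈ I := by
    rintro ((i | i) | i)
    · exact Ideal.mul_mem_left _ _ hf1
    · exact Ideal.mul_mem_left _ _ hf2
    · have := sub_mem (Ideal.mul_mem_right (v i) _ hf3) (hKI (hrK i))
      rwa [sub_sub_cancel] at this
  have hWind : ∀ c : t → MvPolynomial (Fin d) k, ∑ j, c j • W j = 0 → c = 0 := by
    intro c hc0
    rw [Fintype.sum_sum_type, Fintype.sum_sum_type] at hc0
    let u := ∑ i : Fset 2 2, c (Sum.inl (Sum.inl i)) • monomial i.1 (1 : MvPolynomial (Fin d) k)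
    let w := ∑ i : Fset 2 2, c (Sum.inl (Sum.inr i)) • monomial i.1 (1 : MvPolynomial (Fin d) k)
    have hc1 : u * f₁ + w * f₂ + ∑ i, c (Sum.inr i) • r i = 0 := by
      rw [← hc0, Finset.sum_mul, Finset.sum_mul]
      simp only [W, Sum.elim_inl, Sum.elim_inr, smul_mul_assoc]
    have hz : (fun i => c (Sum.inr i)) = 0 := by
      apply hind
      rw [hJ]
      have e : f₃ * ∑ i, c (Sum.inr i) • v i = ∑ i, c (Sum.inr i) • (f₃ * v i - r i)
          + (-u) * f₁ + (-w) * f₂ := by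
        have : ∑ i, c (Sum.inr i) • r i = (-u) * f₁ + (-w) * f₂ := by
          linear_combination hc1
        simp only [smul_sub, Finset.sum_sub_distrib, this, Finset.mul_sum, mul_smul_comm]
        ring
      rw [e]
      refine add_mem (add_mem (Submodule.sum_mem _ fun i _ => ?_) ?_) ?_
      · rw [Algebra.smul_def]
        exact Ideal.mul_mem_left _ _ (hrK i)
      · exact Ideal.mul_mem_left _ _ (Ideal.subset_span (by simp))
      · exact Ideal.mul_mem_left _ _ (Ideal.subset_span (by simp))
    have hz' : ∀ i, c (Sum.inr i) = 0 := fun i => congrFun hz i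
    simp only [hz', zero_smul, Finset.sum_const_zero, add_zero] at hc1
    obtain ⟨hu, hw⟩ := L.low_zero 2 (by norm_num) u w (E_comb _) (E_comb _) hc1
    have hu' := comb_zero _ hu
    have hw' := comb_zero _ hw
    ext1 j
    rcases j with (i | i) | i
    · exact congrFun hu' i
    · exact congrFun hw' i
    · exact hz' i
  obtain ⟨D, hD⟩ : ∃ D, ∀ (j : t) (i : s), coeff i.1 (W j) ∈ E (Fin d) k (D + 1) := by
    have : ∀ x : t × s, ∃ n, coeff x.2.1 (W x.1) ∈ E (Fin d) k n := fun x => E_exists _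
    choose n hn using this
    refine ⟨∑ x, n x, fun j i => E_mono ?_ (hn (j, i))⟩
    have := Finset.single_le_sum (f := n) (fun _ _ => Nat.zero_le _) (Finset.mem_univ (j, i))
    omega
  refine no_count d D H hlim fun n => ?_
  have key := count (k := k) (d := d) I (M ^ (n + 1 + D)) (n + 1) D ?_ (s := s) (t := t)
    (fun i => monomial i.1 (1 : MvPolynomial (Fin d) k)) ?_ (fun j i => coeff i.1 (W j)) ?_ ?_ hD
  · rw [← hH, show n + 1 + D = n + D + 1 by ring, finrank_E, finrank_E] at key
    have c5 : Fintype.card s = 15 := by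
      rw [Fintype.card_coe, card_Fset]; rfl
    have c2 : Fintype.card t = 10 := by
      simp only [t, Fintype.card_sum, Fintype.card_coe, Fintype.card_fin]
      rw [card_Fset]; rfl
    rw [c5, c2] at key
    rw [show n + 1 + D = n + D + 1 by ring]
    exact key
  · intro a ha
    have h3 := Ideal.mem_map_of_mem (C : _ →+* MvPolynomial (Fin 2) (MvPolynomial (Fin d) k))
      (mem_pow_of_low ha)
    rw [Ideal.map_pow] at h3
    refine Ideal.pow_right_mono ?_ _ h3
    rw [idealOfVars, Ideal.map_span, Ideal.span_le]
    rintro _ ⟨_, ⟨j, rfl⟩, rfl⟩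
    exact hM j
  · intro p
    obtain ⟨q, hq, h⟩ := L.reduce' h1 h2 h0 hc p
    refine ⟨fun i => coeff i.1 q, ?_⟩
    rw [← E_expand hq]
    exact hKI h
  · intro c h
    apply hWind
    have h5 : ∑ j, c j • W j ∈ E (Fin 2) (MvPolynomial (Fin d) k) 5 :=
      Submodule.sum_mem _ fun j _ => Submodule.smul_mem _ _ (hW5 j)
    rw [E_expand h5]
    refine Finset.sum_eq_zero fun i _ => ?_
    have := congrFun h i
    simp only [Finset.sum_apply, Pi.smul_apply, Pi.zero_apply] at this
    rw [coeff_sum]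
    simp only [coeff_smul]
    rw [this, zero_smul]
  · intro j
    rw [← E_expand (hW5 j)]
    exact hWI j

end P3b
end C3


namespace C3
section P6a

/-- bihomogeneous total degree -/
def HomP {k : Type} [Field k] {d : ℕ} (n : ℕ) (p : MvPolynomial (Fin 2) (MvPolynomial (Fin d) k)) : Prop :=
  ∀ m e, coeff e (coeff m p) ≠ 0 → m.degree + e.degree = n

theorem sum_monomial {k : Type} [Field k] {d : ℕ} (s : Fin 2 ⊕ Fin d →₀ ℕ) (c : k) :
    sumAlgEquiv k (Fin 2) (Fin d) (monomial s c) =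
      monomial (Finsupp.sumFinsuppAddEquivProdFinsupp s).1
        (monomial (Finsupp.sumFinsuppAddEquivProdFinsupp s).2 c) := by
  have h := AddMonoidAlgebra.curryAlgEquiv_single (R := k) (A := k)
    (Finsupp.sumFinsuppAddEquivProdFinsupp s).1 (Finsupp.sumFinsuppAddEquivProdFinsupp s).2 c
  rw [sumAlgEquiv, AlgEquiv.trans_apply]
  erw [AddMonoidAlgebra.domCongr_single]
  exact h

theorem sum_hom {k : Type} [Field k] {d n : ℕ} {q : MvPolynomial (Fin 2 ⊕ Fin d) k}
    (hq : q.IsHomogeneous n) : HomP n (sumAlgEquiv k (Fin 2) (Fin d) q) := by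
  classical
  intro m e h
  rw [← support_sum_monomial_coeff q, map_sum, coeff_sum, coeff_sum] at h
  obtain ⟨s, hs, h⟩ := Finset.exists_ne_zero_of_sum_ne_zero h
  have hd : s.degree = n := by
    by_contra hne
    exact (mem_support_iff.mp hs) (hq.coeff_eq_zero hne)
  rw [sum_monomial, coeff_monomial] at h
  split_ifs at h with h1
  · rw [coeff_monomial] at h
    split_ifs at h with h2
    · rw [← h1, ← h2, ← hd]
      simp [Finsupp.degree_eq_sum]
    · exact absurd rfl h
  · exact absurd (coeff_zero e) h

theorem linear_prime {k : Type} [Field k] {d : ℕ} {v : MvPolynomial (Fin d) k}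
    (hv : v.IsHomogeneous 1) (h0 : v ≠ 0) : Prime v := by
  rw [← UniqueFactorizationMonoid.irreducible_iff_prime]
  apply irreducible_of_totalDegree_eq_one (hv.totalDegree h0)
  intro x hx
  rw [isUnit_iff_ne_zero]
  rintro rfl
  exact h0 (by ext i; simpa using hx i)

theorem relprime_of_pow {A : Type} [CommRing A] [IsDomain A] {G₁ G₂ : MvPolynomial (Fin 2) A} {n : ℕ}
    (h0 : X 0 ^ n ∈ Ideal.span {G₁, G₂}) (h1 : X 1 ^ n ∈ Ideal.span {G₁, G₂}) :
    IsRelPrime G₁ G₂ := by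
  intro h hG1 hG2
  have hle : Ideal.span {G₁, G₂} ≤ Ideal.span {h} := by
    rw [Ideal.span_le]
    rintro x (rfl | rfl)
    · exact Ideal.mem_span_singleton.mpr hG1
    · exact Ideal.mem_span_singleton.mpr hG2
  have d0 := Ideal.mem_span_singleton.mp (hle h0)
  have d1 := Ideal.mem_span_singleton.mp (hle h1)
  have hp : Prime (X 0 : MvPolynomial (Fin 2) A) := MvPolynomial.X_prime
  obtain ⟨i, hi, ha⟩ := (dvd_prime_pow hp n).mp d0
  rcases Nat.eq_zero_or_pos i with rfl | hi
  · rw [pow_zero] at ha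
    exact (associated_one_iff_isUnit).mp ha
  · exfalso
    have h2 : (X 0 : MvPolynomial (Fin 2) A) ∣ X 1 ^ n :=
      ((dvd_pow_self _ hi.ne').trans ha.symm.dvd).trans d1
    have h3 := hp.dvd_of_dvd_pow h2
    obtain ⟨c, hc⟩ := h3
    have := congrArg (eval (fun i : Fin 2 => if i = 0 then (0 : A) else 1)) hc
    simp at this

theorem pow_mem {k : Type} [Field k] [IsAlgClosed k] {g₁ g₂ : MvPolynomial (Fin 2) k}
    (h : ∀ c : Fin 2 → k, eval c g₁ = 0 → eval c g₂ = 0 → c = 0) :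
    ∃ n, X 0 ^ n ∈ Ideal.span {g₁, g₂} ∧ X 1 ^ n ∈ Ideal.span {g₁, g₂} := by
  have : ∀ i, (X i : MvPolynomial (Fin 2) k) ∈ (Ideal.span {g₁, g₂}).radical := by
    intro i
    rw [← vanishingIdeal_zeroLocus_eq_radical (K := k)]
    intro c hc
    have h1 := hc g₁ (Ideal.subset_span (by simp))
    have h2 := hc g₂ (Ideal.subset_span (by simp))
    rw [h c h1 h2]
    simp
  obtain ⟨a, ha⟩ := this 0
  obtain ⟨b, hb⟩ := this 1
  exact ⟨a + b, by rw [pow_add]; exact Ideal.mul_mem_right _ _ ha,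
    by rw [pow_add]; exact Ideal.mul_mem_left _ _ hb⟩

theorem idealHeight_le {R : Type} [CommRing R] {J p : Ideal R} (hp : p.IsPrime) (h : J ≤ p) :
    idealHeight J ≤ p.height := by
  have e : p.height = Order.height (⟨p, hp⟩ : {q : Ideal R // q.IsPrime}) := by
    rw [PrimeSpectrum.height_eq_orderHeight ⟨p, hp⟩]
    have := Order.height_orderIso (α := {q : Ideal R // q.IsPrime}) (β := PrimeSpectrum R)
      ⟨⟨fun q => ⟨q.1, q.2⟩, fun q => ⟨q.1, q.2⟩, fun _ => rfl, fun _ => rfl⟩, Iff.rfl⟩ ⟨p, hp⟩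
    exact this
  rw [e]
  exact iInf₂_le (⟨p, hp⟩ : {q : Ideal R // q.IsPrime}) h

theorem relprime_of_height {k : Type} [Field k] {N : ℕ} {f₁ f₂ : MvPolynomial (Fin N) k}
    (h : idealHeight (Ideal.span {f₁, f₂}) = 2) : IsRelPrime f₁ f₂ := by
  intro h' h1 h2
  by_contra hu
  have hle : Ideal.span {f₁, f₂} ≤ Ideal.span {h'} := by
    rw [Ideal.span_le]
    rintro x (rfl | rfl)
    · exact Ideal.mem_span_singleton.mpr h1
    · exact Ideal.mem_span_singleton.mpr h2
  obtain ⟨p, hp⟩ := Ideal.exists_le_maximal (Ideal.span {h'}) (by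
    rwa [Ne, Ideal.span_singleton_eq_top])
  have hpp := hp.1.isPrime
  obtain ⟨q, hq, hqp⟩ := Ideal.exists_minimalPrimes_le hp.2
  have h3 := Ideal.height_le_one_of_isPrincipal_of_mem_minimalPrimes _ q hq
  have h4 := idealHeight_le hq.isPrime (hle.trans hq.le)
  rw [h] at h4
  have := h4.trans h3
  norm_num at this

end P6a
end C3


namespace C3
section P6b
variable {k : Type} [Field k] {N : ℕ}

/-- translation `f ↦ f(X + T P)` -/
def trans (P : Fin N → k) : MvPolynomial (Fin N) k →ₐ[k] Polynomial (MvPolynomial (Fin N) k) :=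
  aeval (fun i => Polynomial.C (X i) + Polynomial.C (C (P i)) * Polynomial.X)

theorem trans_S (P : Fin N → k) {f : MvPolynomial (Fin N) k} {n : ℕ} (hf : f.IsHomogeneous n) :
    (trans P f).natDegree ≤ n ∧ (trans P f).coeff n = C (eval P f) := by
  classical
  have hX : ∀ i, (trans P (X i)).natDegree ≤ 1 ∧ (trans P (X i)).coeff 1 = C (eval P (X i)) := by
    intro i
    rw [trans, aeval_X]
    constructor
    · refine (Polynomial.natDegree_add_le _ _).trans (max_le (by simp) ?_)
      refine Polynomial.natDegree_C_mul_le _ _ |>.trans (by simp)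
    · simp [Polynomial.coeff_C]
  have hmul : ∀ (a b : MvPolynomial (Fin N) k) (n m : ℕ),
      ((trans P a).natDegree ≤ n ∧ (trans P a).coeff n = C (eval P a)) →
      ((trans P b).natDegree ≤ m ∧ (trans P b).coeff m = C (eval P b)) →
      ((trans P (a * b)).natDegree ≤ n + m ∧ (trans P (a * b)).coeff (n + m) = C (eval P (a * b))) := by
    intro a b n m ha hb
    rw [map_mul]
    constructor
    · exact Polynomial.natDegree_mul_le_of_le ha.1 hb.1
    · rw [Polynomial.coeff_mul_add_eq_of_natDegree_le ha.1 hb.1, ha.2, hb.2, map_mul, map_mul]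
  have hC : ∀ c : k, ((trans P (C c)).natDegree ≤ 0 ∧ (trans P (C c)).coeff 0 = C (eval P (C c))) := by
    intro c
    have : trans P (C c) = Polynomial.C (C c) := by
      rw [trans, aeval_C]; rfl
    rw [this]
    simp
  have hmon : ∀ s : Fin N →₀ ℕ, (trans P (monomial s 1)).natDegree ≤ s.degree ∧
      (trans P (monomial s 1)).coeff s.degree = C (eval P (monomial s 1)) := by
    intro s
    induction s using Finsupp.induction_linear with
    | zero =>
      have := hC 1
      simpa using this
    | add s t hs ht =>
      have := hmul _ _ _ _ hs ht
      rwa [monomial_mul, one_mul, ← map_add] at this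
    | single i a =>
      induction a with
      | zero =>
        have := hC 1
        simpa using this
      | succ a ih =>
        have := hmul _ _ _ _ ih (hX i)
        rw [X, monomial_mul, one_mul, ← Finsupp.single_add] at this
        simpa only [Finsupp.degree_single] using this
  have hterm : ∀ s ∈ f.support, (trans P (monomial s (coeff s f))).natDegree ≤ n ∧
      (trans P (monomial s (coeff s f))).coeff n = C (eval P (monomial s (coeff s f))) := by
    intro s hs
    have hd : s.degree = n := by
      by_contra hne
      exact (mem_support_iff.mp hs) (hf.coeff_eq_zero hne)
    have := hmul _ _ _ _ (hC (coeff s f)) (hmon s)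
    rwa [C_mul_monomial, mul_one, zero_add, hd] at this
  rw [← support_sum_monomial_coeff f, map_sum]
  constructor
  · exact Polynomial.natDegree_sum_le_of_forall_le _ _ fun s hs => (hterm s hs).1
  · rw [Polynomial.finset_sum_coeff, map_sum, map_sum]
    exact Finset.sum_congr rfl fun s hs => (hterm s hs).2

/-- the automorphism of `R[T]` translating by `T P` -/
def transE (P : Fin N → k) : Polynomial (MvPolynomial (Fin N) k) →+* Polynomial (MvPolynomial (Fin N) k) :=
  Polynomial.eval₂RingHom (trans P).toRingHom Polynomial.X

theorem transE_C (P : Fin N → k) (f) : transE P (Polynomial.C f) = trans P f := by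
  simp [transE]

theorem transE_transE (P Q : Fin N → k) (h : ∀ i, P i + Q i = 0) (p) : transE P (transE Q p) = p := by
  have : (transE P).comp (transE Q) = RingHom.id _ := by
    apply Polynomial.ringHom_ext'
    · apply MvPolynomial.ringHom_ext
      · intro r
        have e : ∀ P : Fin N → k, trans P (C r) = Polynomial.C (C r) := fun P => by
          rw [trans, aeval_C]; rfl
        simp only [RingHom.comp_apply, transE_C, e, RingHom.id_apply]
      · intro i
        have e : ∀ r, trans P (C r) = Polynomial.C (C r) := fun r => by
          rw [trans, aeval_C]; rfl
        have e' : transE P Polynomial.X = Polynomial.X := by simp [transE]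
        have e2 : ∀ P : Fin N → k, trans P (X i) =
          Polynomial.C (X i) + Polynomial.C (C (P i)) * Polynomial.X := fun P => by rw [trans, aeval_X]
        simp only [RingHom.comp_apply, transE_C, e2, RingHom.id_apply, map_add, map_mul, e, e']
        rw [add_assoc, ← add_mul, ← Polynomial.C_add, ← C_add, h]
        simp
    · simp [transE]
  exact congrArg (fun φ => φ p) this

theorem trans_relprime (P : Fin N → k) {f₁ f₂ : MvPolynomial (Fin N) k} (h0 : f₁ ≠ 0)
    (h : IsRelPrime f₁ f₂) : IsRelPrime (trans P f₁) (trans P f₂) := by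
  intro g h1 h2
  have hn : ∀ f, transE (-P) (trans P f) = Polynomial.C f := fun f => by
    rw [← transE_C, transE_transE _ _ (by simp)]
  have h1' := map_dvd (transE (-P)) h1
  have h2' := map_dvd (transE (-P)) h2
  rw [hn] at h1' h2'
  have hd : (transE (-P) g).natDegree = 0 := by
    have := Polynomial.natDegree_le_of_dvd h1' (by simpa using h0)
    simpa using this
  obtain ⟨a, ha⟩ := Polynomial.natDegree_eq_zero.mp hd
  rw [← ha, Polynomial.C_dvd_iff_dvd_coeff] at h1' h2'
  have d1 := h1' 0
  have d2 := h2' 0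
  rw [Polynomial.coeff_C_zero] at d1 d2
  have hu := h d1 d2
  have : IsUnit (transE P (transE (-P) g)) := by
    rw [← ha]
    exact (hu.map Polynomial.C).map _
  rwa [transE_transE _ _ (by simp)] at this

theorem exists_elim {R : Type} [CommRing R] [IsDomain R] [IsIntegrallyClosed R] {F₁ F₂ : Polynomial R} {n : ℕ}
    (hn : n ≠ 0) (hd : F₁.natDegree ≤ n) (hl : IsUnit (F₁.coeff n)) (h : IsRelPrime F₁ F₂) :
    ∃ D : R, D ≠ 0 ∧ ∃ u v, F₁ * u + F₂ * v = Polynomial.C D := by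
  classical
  have hne : F₁.coeff n ≠ 0 := hl.ne_zero
  have hdeg : F₁.natDegree = n := le_antisymm hd (Polynomial.le_natDegree_of_ne_zero hne)
  obtain ⟨c, hc⟩ := hl
  let G := Polynomial.C (↑c⁻¹ : R) * F₁
  have hGm : G.Monic := by
    have : G.natDegree ≤ n := (Polynomial.natDegree_C_mul_le _ _).trans hd
    refine Polynomial.monic_of_natDegree_le_of_coeff_eq_one n this ?_
    rw [Polynomial.coeff_C_mul, ← hc]; simp
  have hF : F₁ = Polynomial.C (c : R) * G := by
    simp only [G]; rw [← mul_assoc, ← Polynomial.C_mul]; simp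
  refine ⟨F₁.resultant F₂, ?_, ?_⟩
  · intro hres
    let K := FractionRing R
    have hi : Function.Injective (algebraMap R K) := IsFractionRing.injective R K
    have h1 := Polynomial.resultant_map_map F₁ F₂ F₁.natDegree F₂.natDegree (algebraMap R K)
    rw [hres, map_zero] at h1
    rw [← Polynomial.natDegree_map_eq_of_injective hi F₁,
      ← Polynomial.natDegree_map_eq_of_injective hi F₂, Polynomial.resultant_eq_zero_iff] at h1
    apply h1.2
    rw [← EuclideanDomain.gcd_isUnit_iff]
    set g := EuclideanDomain.gcd (F₁.map (algebraMap R K)) (F₂.map (algebraMap R K)) with hg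
    have hg1 : g ∣ F₁.map (algebraMap R K) := EuclideanDomain.gcd_dvd_left _ _
    have hg2 : g ∣ F₂.map (algebraMap R K) := EuclideanDomain.gcd_dvd_right _ _
    have hgG : g ∣ G.map (algebraMap R K) := by
      simp only [G, Polynomial.map_mul]
      exact hg1.mul_left _
    have hg0 : g ≠ 0 := by
      rintro h0
      rw [h0, zero_dvd_iff] at hgG
      exact (hGm.map (algebraMap R K)).ne_zero hgG
    obtain ⟨g', hg'⟩ := IsIntegrallyClosed.eq_map_mul_C_of_dvd K hGm hgG
    have hlu : IsUnit (Polynomial.C g.leadingCoeff) :=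
      (isUnit_iff_ne_zero.mpr (by simpa using hg0)).map Polynomial.C
    have hg'm : g'.Monic := by
      have h3 := congrArg Polynomial.leadingCoeff hg'
      rw [Polynomial.leadingCoeff_mul, Polynomial.leadingCoeff_C] at h3
      have h4 : (g'.map (algebraMap R K)).leadingCoeff = 1 := by
        have h5 : g.leadingCoeff ≠ 0 := by simpa using hg0
        exact mul_right_cancel₀ h5 (by rw [h3, one_mul])
      rw [Polynomial.leadingCoeff_map_of_injective hi] at h4
      exact hi (by rw [h4, map_one])
    have hd' : ∀ F : Polynomial R, g ∣ F.map (algebraMap R K) → g' ∣ F := by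
      intro F hF
      rw [← Polynomial.map_dvd_map (algebraMap R K) hi hg'm]
      exact (Dvd.intro _ hg').trans hF
    have hu := h (hd' _ hg1) (hd' _ hg2)
    rw [← hg']
    exact (hu.map (Polynomial.mapRingHom (algebraMap R K))).mul hlu
  · obtain ⟨p, q, _, _, e⟩ := Polynomial.exists_mul_add_mul_eq_C_resultant F₁ F₂ le_rfl le_rfl
      (by left; omega)
    exact ⟨p, q, e⟩

theorem trans_eval (P Q : Fin N → k) (t : k) (f : MvPolynomial (Fin N) k) :
    eval Q ((trans P f).eval (C t)) = eval (Q + t • P) f := by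
  have : ((eval Q).comp (Polynomial.evalRingHom (C t))).comp (trans P).toRingHom = eval (Q + t • P) := by
    apply MvPolynomial.ringHom_ext
    · intro r
      have : trans P (C r) = Polynomial.C (C r) := by
        rw [trans, aeval_C]; rfl
      simp [this]
    · intro i
      have : trans P (X i) = Polynomial.C (X i) + Polynomial.C (C (P i)) * Polynomial.X := by
        rw [trans, aeval_X]
      change eval Q ((trans P (X i)).eval (C t)) = _
      rw [this, Polynomial.eval_add, Polynomial.eval_mul, Polynomial.eval_C, Polynomial.eval_C,
        Polynomial.eval_X, map_add, map_mul, eval_X, eval_C, eval_C, eval_X, Pi.add_apply,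
        Pi.smul_apply, smul_eq_mul, mul_comm]
  exact congrArg (fun φ => φ f) this

theorem eval_smul_hom {f : MvPolynomial (Fin N) k} {n : ℕ} (hf : f.IsHomogeneous n) (a : k) (v : Fin N → k) :
    eval (a • v) f = a ^ n * eval v f := by
  classical
  rw [eval_eq, eval_eq, Finset.mul_sum]
  refine Finset.sum_congr rfl fun s hs => ?_
  have hd : s.degree = n := by
    by_contra hne
    exact (mem_support_iff.mp hs) (hf.coeff_eq_zero hne)
  simp only [Pi.smul_apply, smul_eq_mul, mul_pow]
  rw [Finset.prod_mul_distrib, Finset.prod_pow_eq_pow_sum]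
  have : ∑ i ∈ s.support, s i = n := hd
  rw [this]; ring

theorem exists_plane [IsAlgClosed k] {f₁ f₂ : MvPolynomial (Fin N) k} (h1 : f₁.IsHomogeneous 3)
    (h2 : f₂.IsHomogeneous 3) (h0 : f₁ ≠ 0) (h : IsRelPrime f₁ f₂) :
    ∃ P Q : Fin N → k, ∀ a b : k, eval (a • P + b • Q) f₁ = 0 → eval (a • P + b • Q) f₂ = 0 →
      a = 0 ∧ b = 0 := by
  haveI : Infinite k := IsAlgClosed.instInfinite
  have hex : ∀ f : MvPolynomial (Fin N) k, f ≠ 0 → ∃ P, eval P f ≠ 0 := by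
    intro f hf
    by_contra hcon
    push Not at hcon
    exact hf (MvPolynomial.funext fun x => by rw [hcon x, map_zero])
  obtain ⟨P, hP⟩ := hex f₁ h0
  obtain ⟨D, hD, u, v, huv⟩ := exists_elim (n := 3) (by norm_num) (trans_S P h1).1
    (by rw [(trans_S P h1).2]; exact (isUnit_iff_ne_zero.mpr hP).map C) (trans_relprime P h0 h)
  obtain ⟨Q, hQ⟩ := hex D hD
  refine ⟨P, Q, fun a b e1 e2 => ?_⟩
  have hb : b = 0 := by
    by_contra hb
    have e : a • P + b • Q = b • (Q + (a / b) • P) := by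
      rw [smul_add, smul_smul, mul_div_cancel₀ _ hb, add_comm]
    rw [e, eval_smul_hom h1] at e1
    rw [e, eval_smul_hom h2] at e2
    have e1' := (mul_eq_zero.mp e1).resolve_left (pow_ne_zero _ hb)
    have e2' := (mul_eq_zero.mp e2).resolve_left (pow_ne_zero _ hb)
    have := congrArg (fun p => eval Q (Polynomial.eval (C (a / b)) p)) huv
    simp only [Polynomial.eval_add, Polynomial.eval_mul, Polynomial.eval_C, map_add, map_mul,
      trans_eval, e1', e2', zero_mul, add_zero] at this
    exact hQ this.symm
  subst hb
  rw [zero_smul, add_zero, eval_smul_hom h1] at e1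
  refine ⟨?_, rfl⟩
  exact pow_eq_zero_iff (n := 3) (by norm_num) |>.mp ((mul_eq_zero.mp e1).resolve_right hP)

end P6b
end C3


namespace C3
section P6c
variable {k : Type} [Field k] {N : ℕ}

theorem exists_basis {P Q : Fin N → k} (hli : LinearIndependent k ![P, Q]) :
    ∃ B : Module.Basis (Fin 2 ⊕ Fin (N - 2)) k (Fin N → k), B (Sum.inl 0) = P ∧ B (Sum.inl 1) = Q := by
  let B₀ := Module.Basis.sumExtend hli
  haveI : Finite (Fin 2 ⊕ Module.Basis.sumExtendIndex hli) := Module.Finite.finite_basis B₀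
  haveI : Finite (Module.Basis.sumExtendIndex hli) :=
    Finite.of_injective (Sum.inr : _ → Fin 2 ⊕ Module.Basis.sumExtendIndex hli) Sum.inr_injective
  have hc := Module.finrank_eq_nat_card_basis B₀
  rw [Module.finrank_fin_fun, Nat.card_sum, Nat.card_fin] at hc
  have hc' : Nat.card (Module.Basis.sumExtendIndex hli) = N - 2 := by omega
  let ε := Finite.equivFinOfCardEq hc'
  refine ⟨B₀.reindex (Equiv.sumCongr (Equiv.refl _) ε), ?_, ?_⟩
  · rw [Module.Basis.reindex_apply]
    simp [B₀, Module.Basis.sumExtend]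
    rfl
  · rw [Module.Basis.reindex_apply]
    simp [B₀, Module.Basis.sumExtend]
    rfl

/-- linear change of coordinates -/
def linE {s : Type} [Fintype s] [DecidableEq s] (B : Module.Basis s k (Fin N → k)) :
    MvPolynomial (Fin N) k ≃ₐ[k] MvPolynomial s k :=
  AlgEquiv.ofAlgHom (bind₁ ((Pi.basisFun k (Fin N)).toMatrix B).toMvPolynomial)
    (bind₁ (B.toMatrix (Pi.basisFun k (Fin N))).toMvPolynomial)
    (by
      apply MvPolynomial.algHom_ext
      intro i
      rw [AlgHom.comp_apply, bind₁_X_right, ← Matrix.toMvPolynomial_mul,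
        Module.Basis.toMatrix_mul_toMatrix_flip, Matrix.toMvPolynomial_one]
      rfl)
    (by
      apply MvPolynomial.algHom_ext
      intro i
      rw [AlgHom.comp_apply, bind₁_X_right, ← Matrix.toMvPolynomial_mul,
        Module.Basis.toMatrix_mul_toMatrix_flip, Matrix.toMvPolynomial_one]
      rfl)

theorem linE_hom {s : Type} [Fintype s] [DecidableEq s] (B : Module.Basis s k (Fin N → k))
    {f : MvPolynomial (Fin N) k} {n : ℕ} (hf : f.IsHomogeneous n) : (linE B f).IsHomogeneous n := by
  have := hf.aeval ((Pi.basisFun k (Fin N)).toMatrix B).toMvPolynomial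
    (fun i => Matrix.toMvPolynomial_isHomogeneous _ i)
  rw [one_mul] at this
  exact this

theorem linE_eval {s : Type} [Fintype s] [DecidableEq s] (B : Module.Basis s k (Fin N → k))
    (f : MvPolynomial (Fin N) k) (c : s → k) : eval c (linE B f) = eval (∑ j, c j • B j) f := by
  have h1 : eval c (linE B f) = aeval (fun i => aeval c
      (((Pi.basisFun k (Fin N)).toMatrix B).toMvPolynomial i)) f := by
    rw [← aeval_bind₁]; rfl
  rw [h1]
  have h2 : (fun i => aeval c (((Pi.basisFun k (Fin N)).toMatrix B).toMvPolynomial i)) =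
      ∑ j, c j • B j := by
    ext1 i
    have := Matrix.toMvPolynomial_eval_eq_apply ((Pi.basisFun k (Fin N)).toMatrix B) i c
    rw [Finset.sum_apply]
    refine Eq.trans this ?_
    simp [Matrix.mulVec, dotProduct, Module.Basis.toMatrix_apply, mul_comm]
  rw [h2]; rfl

theorem linE_symm_X {s : Type} [Fintype s] [DecidableEq s] (B : Module.Basis s k (Fin N → k)) (j : s) :
    (linE B).symm (X j) ∈ Ideal.span (Set.range (X : Fin N → MvPolynomial (Fin N) k)) := by
  have : (linE B).symm (X j) = (B.toMatrix (Pi.basisFun k (Fin N))).toMvPolynomial j :=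
    bind₁_X_right _ _
  rw [this, Matrix.toMvPolynomial]
  refine Submodule.sum_mem _ fun i _ => ?_
  have h : ∀ r : k, (monomial (Finsupp.single i 1) r : MvPolynomial (Fin N) k) = C r * X i := fun r => by
    rw [C_mul_X_eq_monomial]
  rw [h]
  exact Ideal.mul_mem_left _ _ (Ideal.subset_span ⟨i, rfl⟩)

theorem sum_eval {d : ℕ} (q : MvPolynomial (Fin 2 ⊕ Fin d) k) (c : Fin 2 → k) :
    eval c (MvPolynomial.map constantCoeff (sumAlgEquiv k (Fin 2) (Fin d) q)) =
      eval (Sum.elim c 0) q := by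
  have : ((eval c).comp (MvPolynomial.map (constantCoeff (R := k) (σ := Fin d)))).comp
      (sumAlgEquiv k (Fin 2) (Fin d) : MvPolynomial (Fin 2 ⊕ Fin d) k →+* MvPolynomial (Fin 2) (MvPolynomial (Fin d) k)) = MvPolynomial.eval (Sum.elim c 0) := by
    apply MvPolynomial.ringHom_ext
    · intro r
      simp
    · rintro (i | i) <;> simp
  exact congrArg (fun φ => φ q) this

theorem exists_coord {P Q : Fin N → k} (hli : LinearIndependent k ![P, Q]) :
    ∃ e : MvPolynomial (Fin N) k ≃ₐ[k] MvPolynomial (Fin 2) (MvPolynomial (Fin (N - 2)) k),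
      (∀ f n, f.IsHomogeneous n → HomP n (e f)) ∧
      (∀ f c, eval c (MvPolynomial.map constantCoeff (e f)) = eval (c 0 • P + c 1 • Q) f) ∧
      (∀ j, e.symm (C (X j)) ∈ Ideal.span (Set.range (X : Fin N → MvPolynomial (Fin N) k))) := by
  classical
  obtain ⟨B, h0, h1⟩ := exists_basis hli
  refine ⟨(linE B).trans (sumAlgEquiv k (Fin 2) (Fin (N - 2))), ?_, ?_, ?_⟩
  · intro f n hf
    exact sum_hom (linE_hom B hf)
  · intro f c
    rw [AlgEquiv.trans_apply, sum_eval, linE_eval]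
    congr 2
    rw [Fintype.sum_sum_type, Fin.sum_univ_two]
    simp [h0, h1]
  · intro j
    have : (sumAlgEquiv k (Fin 2) (Fin (N - 2))).symm (C (X j)) = X (Sum.inr j) := by simp
    rw [AlgEquiv.symm_trans_apply, this]
    exact linE_symm_X B _

section hom
variable {d : ℕ} {p : MvPolynomial (Fin 2) (MvPolynomial (Fin d) k)}

theorem HomP.E {n : ℕ} (h : HomP n p) : p ∈ E (Fin 2) (MvPolynomial (Fin d) k) (n + 1) := by
  intro m hm
  ext e
  by_contra hne
  have := h m e (by simpa using hne)
  omega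

theorem HomP.coeff {n r : ℕ} (h : HomP n p) {m : Fin 2 →₀ ℕ} (hm : m.degree + r = n) :
    (coeff m p).IsHomogeneous r := by
  intro e he
  have := h m e he
  rw [Pi.one_def, ← Finsupp.degree_eq_weight_one]
  omega

theorem HomP.hom {n : ℕ} (h : HomP n p) :
    (MvPolynomial.map (constantCoeff (R := k) (σ := Fin d)) p).IsHomogeneous n := by
  intro m hm
  rw [coeff_map, constantCoeff_eq] at hm
  have := h m 0 hm
  rw [Pi.one_def, ← Finsupp.degree_eq_weight_one]
  simpa using this

theorem HomP.comp {n : ℕ} (h : HomP n p) : homogeneousComponent n p =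
    MvPolynomial.map (algebraMap k (MvPolynomial (Fin d) k))
      (MvPolynomial.map (constantCoeff (R := k) (σ := Fin d)) p) := by
  classical
  ext m e
  rw [coeff_homogeneousComponent, coeff_map, coeff_map, algebraMap_eq, coeff_C, constantCoeff_eq]
  split_ifs with h1 h2 h2
  · rw [h2]
  · by_contra hne
    have := h m e hne
    have h3 : e.degree = 0 := by omega
    rw [Finsupp.degree_eq_zero_iff] at h3
    exact h2 h3.symm
  · rw [coeff_zero]
    by_contra hne
    have := h m 0 (Ne.symm hne)
    simp at this
    exact h1 this
  · rw [coeff_zero]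

end hom

theorem hom_ne_zero {s : Type} {f₁ f₂ : MvPolynomial s k} (h2 : f₂.IsHomogeneous 3)
    (h : IsRelPrime f₁ f₂) : f₁ ≠ 0 := by
  rintro rfl
  have hu : IsUnit f₂ := h (dvd_zero _) dvd_rfl
  have h3 := hu.map (constantCoeff (R := k) (σ := s))
  rw [constantCoeff_eq, h2.coeff_eq_zero (by simp)] at h3
  exact not_isUnit_zero h3

theorem main [IsAlgClosed k] (f₁ f₂ f₃ : MvPolynomial (Fin N) k)
    (hf₁ : f₁.IsHomogeneous 3) (hf₂ : f₂.IsHomogeneous 3) (hf₃ : f₃.IsHomogeneous 3)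
    (hht₁₂ : idealHeight (Ideal.span {f₁, f₂}) = 2)
    (he : HasMultiplicity (Ideal.span {f₁, f₂, f₃}) (N - 2) 6) :
    PD (MvPolynomial (Fin N) k) (MvPolynomial (Fin N) k ⧸ Ideal.span {f₁, f₂, f₃}) 3 := by
  classical
  have hrel := relprime_of_height hht₁₂
  have hf0 := hom_ne_zero hf₂ hrel
  obtain ⟨P, Q, hPQ⟩ := exists_plane hf₁ hf₂ hf0 hrel
  have hli : LinearIndependent k ![P, Q] := by
    rw [LinearIndependent.pair_iff]
    intro a b hab
    apply hPQ a b
    · rw [hab, MvPolynomial.eval_zero, constantCoeff_eq, hf₁.coeff_eq_zero (by simp)]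
    · rw [hab, MvPolynomial.eval_zero, constantCoeff_eq, hf₂.coeff_eq_zero (by simp)]
  obtain ⟨e, he1, he2, he3⟩ := exists_coord hli
  have p1 := he1 f₁ 3 hf₁
  have p2 := he1 f₂ 3 hf₂
  have p3 := he1 f₃ 3 hf₃
  set A := MvPolynomial (Fin (N - 2)) k with hA
  have hz : ∀ c : Fin 2 → k, eval c (MvPolynomial.map constantCoeff (e f₁)) = 0 →
      eval c (MvPolynomial.map constantCoeff (e f₂)) = 0 → c = 0 := by
    intro c h1 h2
    rw [he2] at h1 h2
    have := hPQ _ _ h1 h2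
    ext i
    fin_cases i
    · exact this.1
    · exact this.2
  obtain ⟨n, hn0, hn1⟩ := pow_mem hz
  have hc := relprime_of_pow hn0 hn1
  have hg0 := hom_ne_zero p2.hom hc
  have hinj : Function.Injective (MvPolynomial.map (algebraMap k A) :
      MvPolynomial (Fin 2) k → MvPolynomial (Fin 2) A) :=
    map_injective _ (C_injective _ _)
  have hmapn : ∀ i : Fin 2, X i ^ n ∈ Ideal.span
      {MvPolynomial.map constantCoeff (e f₁), MvPolynomial.map constantCoeff (e f₂)} →
      (X i : MvPolynomial (Fin 2) A) ^ n ∈ Ideal.span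
        {MvPolynomial.map (algebraMap k A) (MvPolynomial.map constantCoeff (e f₁)),
          MvPolynomial.map (algebraMap k A) (MvPolynomial.map constantCoeff (e f₂))} := by
    intro i hi
    have := Ideal.mem_map_of_mem (MvPolynomial.map (algebraMap k A)) hi
    rw [Ideal.map_span, Set.image_pair, map_pow, map_X] at this
    exact this
  have L : LF (e f₁) (e f₂) (MvPolynomial.map (algebraMap k A) (MvPolynomial.map constantCoeff (e f₁)))
      (MvPolynomial.map (algebraMap k A) (MvPolynomial.map constantCoeff (e f₂))) :=
    { e1 := p1.E
      e2 := p2.E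
      c1 := p1.comp
      c2 := p2.comp
      h0 := fun h => hg0 (hinj (by rw [h, map_zero]))
      hc := relprime_of_pow (hmapn 0 hn0) (hmapn 1 hn1) }
  let J : Ideal (MvPolynomial (Fin 2) A) :=
    Submodule.comap (LinearMap.mulLeft (MvPolynomial (Fin 2) A) (e f₃)) (Ideal.span {e f₁, e f₂})
  have hJ : ∀ r, r ∈ J ↔ e f₃ * r ∈ Ideal.span {e f₁, e f₂} := fun r => Iff.rfl
  have hspan : ∀ x y z, Ideal.map (e : MvPolynomial (Fin N) k →+* MvPolynomial (Fin 2) A)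
      (Ideal.span {x, y, z}) = Ideal.span {e x, e y, e z} := by
    intro x y z
    rw [Ideal.map_span, Set.image_insert_eq, Set.image_pair]; rfl
  have hrk := rank_le p1.hom p2.hom hg0 hc L J hJ
    (Ideal.map (e : MvPolynomial (Fin N) k →+* MvPolynomial (Fin 2) A)
      (Ideal.span (Set.range (X : Fin N → MvPolynomial (Fin N) k))))
    (fun j => by
      have := Ideal.mem_map_of_mem (e : MvPolynomial (Fin N) k →+* MvPolynomial (Fin 2) A) (he3 j)
      simpa using this)
    (hilbertSamuelFn (Ideal.span {f₁, f₂, f₃}))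
    (fun n => by
      rw [hilbertSamuelFn]
      refine (Ideal.quotientEquivAlg _ _ e ?_).toLinearEquiv.finrank_eq
      rw [Ideal.map_sup, Ideal.map_pow]
      congr 1
      exact (hspan _ _ _).symm)
    he
  have hfree : Module.Free A (MvPolynomial (Fin 2) A ⧸ J) :=
    free_of_data p1.hom p2.hom p3.hom hg0 hc L p3.E p3.comp
      (homogeneousSubmodule (Fin (N - 2)) k 1)
      (fun v hv => by
        by_cases h : v = 0
        · exact Or.inl h
        · exact Or.inr (linear_prime hv h))
      (fun m hm => p1.coeff (by omega)) (fun m hm => p2.coeff (by omega))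
      (fun m hm => p3.coeff (by omega)) J hJ hrk
  have hpd : PD (MvPolynomial (Fin 2) A) (MvPolynomial (Fin 2) A ⧸ J) 2 := by
    refine PD.of_free_quot (A := A) (fun i => Ideal.Quotient.mk J (X i)) ?_
    intro p m
    obtain ⟨m, rfl⟩ := Ideal.Quotient.mk_surjective m
    have h : aeval (fun i => Ideal.Quotient.mk J (X i)) = Ideal.Quotient.mkₐ A J := by
      apply MvPolynomial.algHom_ext
      intro i
      rw [aeval_X]; rfl
    rw [h]
    rfl
  have hrel' : IsRelPrime (e f₁) (e f₂) := by
    intro h h1 h2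
    have h1' := map_dvd e.symm h1
    have h2' := map_dvd e.symm h2
    rw [e.symm_apply_apply] at h1' h2'
    have := (hrel h1' h2').map e
    rwa [e.apply_symm_apply] at this
  have h0' : e f₁ ≠ 0 := by simpa using hf0
  have h3 := PD.three (e f₁) (e f₂) (e f₃)
    (fun u hu => (mul_eq_zero.mp hu).resolve_left h0')
    (fun u hu => hrel'.dvd_of_dvd_mul_left hu) J hJ hpd
  have h4 := PD.ringEquiv (e.symm.toRingEquiv) _ h3
  have h5 : Ideal.map (e.symm.toRingEquiv : MvPolynomial (Fin 2) A →+* MvPolynomial (Fin N) k)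
      (Ideal.span {e f₁, e f₂, e f₃}) = Ideal.span {f₁, f₂, f₃} := by
    rw [Ideal.map_span, Set.image_insert_eq, Set.image_pair]
    simp
  rwa [h5] at h4

theorem final [IsAlgClosed k] (f₁ f₂ f₃ : MvPolynomial (Fin N) k)
    (hf₁ : f₁.IsHomogeneous 3) (hf₂ : f₂.IsHomogeneous 3) (hf₃ : f₃.IsHomogeneous 3)
    (hht₁₂ : idealHeight (Ideal.span {f₁, f₂}) = 2)
    (he : HasMultiplicity (Ideal.span {f₁, f₂, f₃}) (N - 2) 6) :
    pdQuotLE (Ideal.span {f₁, f₂, f₃}) 5 := by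
  have h : PD (MvPolynomial (Fin N) k) (MvPolynomial (Fin N) k ⧸ Ideal.span {f₁, f₂, f₃}) 5 :=
    (main f₁ f₂ f₃ hf₁ hf₂ hf₃ hht₁₂ he).mono (by norm_num)
  haveI : HasProjectiveDimensionLE (ModuleCat.of (MvPolynomial (Fin N) k)
    (MvPolynomial (Fin N) k ⧸ Ideal.span {f₁, f₂, f₃})) 5 := h
  exact exists_resolution 5 _

end P6c
end C3

theorem statement_11
    {k : Type} [Field k] [IsAlgClosed k] {N : ℕ}
    (f₁ f₂ f₃ : MvPolynomial (Fin N) k)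
    (hf₁ : f₁.IsHomogeneous 3) (hf₂ : f₂.IsHomogeneous 3) (hf₃ : f₃.IsHomogeneous 3)
    (hIht : idealHeight (Ideal.span {f₁, f₂, f₃}) = 2)
    (hht₁₂ : idealHeight (Ideal.span {f₁, f₂}) = 2)
    (hht₁₃ : idealHeight (Ideal.span {f₁, f₃}) = 2)
    (hht₂₃ : idealHeight (Ideal.span {f₂, f₃}) = 2)
    (he : HasMultiplicity (Ideal.span {f₁, f₂, f₃}) (N - 2) 6) :
    pdQuotLE (Ideal.span {f₁, f₂, f₃}) 5 := by
  exact C3.final f₁ f₂ f₃ hf₁ hf₂ hf₃ hht₁₂ he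

end
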